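/- In the resolvent-sequence setting, if (H1) holds, then for every ε with 0 < ε < β/12: ∫_{2ε}^{β−2ε} |v¹ₙ′|² dx → 0 and λₙ² ∫_{2ε}^{β−2ε} |v¹ₙ|² dx → 0 as n → ∞. -/

import Mathlib

open Set Filter MeasureTheory

noncomputable section

/-- The resolvent-sequence setting for the locally damped Bresse system with
parameter `ℓ`: a sequence of nonzero frequencies `lam n` with `|lam n| → ∞`,
solutions `Uₙ = (v1,…,v6)` and right-hand sides `Fₙ = (f1,…,f6)` of the resolvent
equations `(lam n)^ℓ (i (lam n) I − 𝒜) Uₙ = Fₙ`, with `‖Uₙ‖_H = 1` and `‖Fₙ‖_H → 0`. -/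
structure BresseSetting (ρ₁ ρ₂ k₁ k₂ k₃ l L β a₀ : ℝ) (ℓ : ℕ) where
  lam : ℕ → ℝ
  v1 : ℕ → ℝ → ℂ
  v2 : ℕ → ℝ → ℂ
  v3 : ℕ → ℝ → ℂ
  v4 : ℕ → ℝ → ℂ
  v5 : ℕ → ℝ → ℂ
  v6 : ℕ → ℝ → ℂ
  f1 : ℕ → ℝ → ℂ
  f2 : ℕ → ℝ → ℂ
  f3 : ℕ → ℝ → ℂ
  f4 : ℕ → ℝ → ℂ
  f5 : ℕ → ℝ → ℂ
  f6 : ℕ → ℝ → ℂ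
  lam_ne : ∀ n, lam n ≠ 0
  lam_tendsto : Tendsto (fun n => |lam n|) atTop atTop
  reg_v1 : ∀ n, ContDiffOn ℝ 2 (v1 n) (Icc 0 L)
  reg_v3 : ∀ n, ContDiffOn ℝ 2 (v3 n) (Icc 0 L)
  reg_v5 : ∀ n, ContDiffOn ℝ 1 (v5 n) (Icc 0 L)
  reg_v5_left : ∀ n, ContDiffOn ℝ 2 (v5 n) (Icc 0 β)
  reg_v5_right : ∀ n, ContDiffOn ℝ 2 (v5 n) (Icc β L)
  reg_v2 : ∀ n, ContDiffOn ℝ 1 (v2 n) (Icc 0 L)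
  reg_v4 : ∀ n, ContDiffOn ℝ 1 (v4 n) (Icc 0 L)
  reg_v6 : ∀ n, ContDiffOn ℝ 1 (v6 n) (Icc 0 L)
  reg_f1 : ∀ n, ContDiffOn ℝ 1 (f1 n) (Icc 0 L)
  reg_f3 : ∀ n, ContDiffOn ℝ 1 (f3 n) (Icc 0 L)
  reg_f5 : ∀ n, ContDiffOn ℝ 1 (f5 n) (Icc 0 L)
  reg_f2 : ∀ n, ContinuousOn (f2 n) (Icc 0 L)
  reg_f4 : ∀ n, ContinuousOn (f4 n) (Icc 0 L)
  reg_f6 : ∀ n, ContinuousOn (f6 n) (Icc 0 L)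
  bc_zero : ∀ n, v1 n 0 = 0 ∧ v2 n 0 = 0 ∧ v3 n 0 = 0 ∧ v4 n 0 = 0 ∧ v5 n 0 = 0 ∧
      v6 n 0 = 0 ∧ f1 n 0 = 0 ∧ f3 n 0 = 0 ∧ f5 n 0 = 0
  bc_L : ∀ n, v1 n L = 0 ∧ v2 n L = 0 ∧ v3 n L = 0 ∧ v4 n L = 0 ∧ v5 n L = 0 ∧
      v6 n L = 0 ∧ f1 n L = 0 ∧ f3 n L = 0 ∧ f5 n L = 0
  eq1 : ∀ n, ∀ x ∈ Ioo (0 : ℝ) β ∪ Ioo β L,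
      Complex.I * (lam n : ℂ) * v1 n x - v2 n x = (lam n : ℂ) ^ (-(ℓ : ℤ)) * f1 n x
  eq2 : ∀ n, ∀ x ∈ Ioo (0 : ℝ) β ∪ Ioo β L,
      Complex.I * (lam n : ℂ) * (ρ₁ : ℂ) * v2 n x
        - (k₁ : ℂ) * deriv (fun y => deriv (v1 n) y + v3 n y + (l : ℂ) * v5 n y) x
        - (l : ℂ) * (k₃ : ℂ) * (deriv (v5 n) x - (l : ℂ) * v1 n x)
        = (ρ₁ : ℂ) * (lam n : ℂ) ^ (-(ℓ : ℤ)) * f2 n x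
  eq3 : ∀ n, ∀ x ∈ Ioo (0 : ℝ) β ∪ Ioo β L,
      Complex.I * (lam n : ℂ) * v3 n x - v4 n x = (lam n : ℂ) ^ (-(ℓ : ℤ)) * f3 n x
  eq4 : ∀ n, ∀ x ∈ Ioo (0 : ℝ) β ∪ Ioo β L,
      Complex.I * (lam n : ℂ) * (ρ₂ : ℂ) * v4 n x
        - (k₂ : ℂ) * deriv (deriv (v3 n)) x
        + (k₁ : ℂ) * (deriv (v1 n) x + v3 n x + (l : ℂ) * v5 n x)
        = (ρ₂ : ℂ) * (lam n : ℂ) ^ (-(ℓ : ℤ)) * f4 n x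
  eq5 : ∀ n, ∀ x ∈ Ioo (0 : ℝ) β ∪ Ioo β L,
      Complex.I * (lam n : ℂ) * v5 n x - v6 n x = (lam n : ℂ) ^ (-(ℓ : ℤ)) * f5 n x
  eq6 : ∀ n, ∀ x ∈ Ioo (0 : ℝ) β ∪ Ioo β L,
      Complex.I * (lam n : ℂ) * (ρ₁ : ℂ) * v6 n x
        - (k₃ : ℂ) * deriv (fun y => deriv (v5 n) y - (l : ℂ) * v1 n y) x
        + (l : ℂ) * (k₁ : ℂ) * (deriv (v1 n) x + v3 n x + (l : ℂ) * v5 n x)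
        + (if x < β then (a₀ : ℂ) else 0) * v6 n x
        = (ρ₁ : ℂ) * (lam n : ℂ) ^ (-(ℓ : ℤ)) * f6 n x
  normU : ∀ n, (∫ x in (0 : ℝ)..L,
      (k₁ * ‖deriv (v1 n) x + v3 n x + (l : ℂ) * v5 n x‖ ^ 2 + ρ₁ * ‖v2 n x‖ ^ 2
        + k₂ * ‖deriv (v3 n) x‖ ^ 2 + ρ₂ * ‖v4 n x‖ ^ 2
        + k₃ * ‖deriv (v5 n) x - (l : ℂ) * v1 n x‖ ^ 2 + ρ₁ * ‖v6 n x‖ ^ 2)) = 1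
  normF : Tendsto (fun n => ∫ x in (0 : ℝ)..L,
      (k₁ * ‖deriv (f1 n) x + f3 n x + (l : ℂ) * f5 n x‖ ^ 2 + ρ₁ * ‖f2 n x‖ ^ 2
        + k₂ * ‖deriv (f3 n) x‖ ^ 2 + ρ₂ * ‖f4 n x‖ ^ 2
        + k₃ * ‖deriv (f5 n) x - (l : ℂ) * f1 n x‖ ^ 2 + ρ₁ * ‖f6 n x‖ ^ 2))
      atTop (nhds 0)



/-- Sequences of continuous functions on `[0,b]`, bounded in `L²`. -/
def BrBd (b : ℝ) (u : ℕ → ℝ → ℂ) : Prop :=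
  (∀ n, ContinuousOn (u n) (Icc 0 b)) ∧ ∃ C, ∀ n, ∫ x in (0 : ℝ)..b, ‖u n x‖ ^ 2 ≤ C

/-- Sequences of continuous functions on `[0,b]`, tending to zero in `L²`. -/
def BrSm (b : ℝ) (u : ℕ → ℝ → ℂ) : Prop :=
  (∀ n, ContinuousOn (u n) (Icc 0 b)) ∧
    Tendsto (fun n => ∫ x in (0 : ℝ)..b, ‖u n x‖ ^ 2) atTop (nhds 0)

/-- Sequences of continuous functions on `[0,b]` whose integrals tend to zero. -/
def BrNg (b : ℝ) (u : ℕ → ℝ → ℂ) : Prop :=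
  (∀ n, ContinuousOn (u n) (Icc 0 b)) ∧
    Tendsto (fun n => ∫ x in (0 : ℝ)..b, u n x) atTop (nhds 0)

section calculus

variable {b : ℝ} {u w : ℕ → ℝ → ℂ}

theorem br_int {E : Type*} [NormedAddCommGroup E] {a b : ℝ} (hb : a ≤ b) {f : ℝ → E}
    (h : ContinuousOn f (Icc a b)) : IntervalIntegrable f volume a b := by
  apply ContinuousOn.intervalIntegrable
  rwa [uIcc_of_le hb]

theorem br_congr {E : Type*} [NormedAddCommGroup E] [NormedSpace ℝ E] {a b : ℝ} (hb : a ≤ b)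
    {f g : ℝ → E} (h : ∀ x ∈ Ioo a b, f x = g x) :
    ∫ x in a..b, f x = ∫ x in a..b, g x := by
  rw [intervalIntegral.integral_of_le hb, intervalIntegral.integral_of_le hb,
    integral_Ioc_eq_integral_Ioo, integral_Ioc_eq_integral_Ioo]
  exact setIntegral_congr_fun measurableSet_Ioo h


theorem BrSm.bd (h : BrSm b u) : BrBd b u := by
  refine ⟨h.1, ?_⟩
  obtain ⟨C, hC⟩ := h.2.bddAbove_range
  exact ⟨C, fun n => hC ⟨n, rfl⟩⟩

theorem br_sq_add (hb : 0 < b) (hu : ContinuousOn (u 0) (Icc 0 b)) (hw : ContinuousOn (w 0) (Icc 0 b)) :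
    ∫ x in (0 : ℝ)..b, ‖u 0 x + w 0 x‖ ^ 2 ≤
      2 * (∫ x in (0 : ℝ)..b, ‖u 0 x‖ ^ 2) + 2 * ∫ x in (0 : ℝ)..b, ‖w 0 x‖ ^ 2 := by
  rw [← intervalIntegral.integral_const_mul, ← intervalIntegral.integral_const_mul,
    ← intervalIntegral.integral_add]
  · apply intervalIntegral.integral_mono_on hb.le
    · exact br_int hb.le (by fun_prop)
    · exact br_int hb.le (by fun_prop)
    · intro x _
      have := norm_add_le (u 0 x) (w 0 x)
      nlinarith [norm_nonneg (u 0 x + w 0 x), sq_nonneg (‖u 0 x‖ - ‖w 0 x‖)]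
  · exact br_int hb.le (by fun_prop)
  · exact br_int hb.le (by fun_prop)

theorem br_sq_nonneg (hb : 0 < b) (f : ℝ → ℂ) : 0 ≤ ∫ x in (0 : ℝ)..b, ‖f x‖ ^ 2 :=
  intervalIntegral.integral_nonneg hb.le (fun x _ => by positivity)

theorem BrBd.add (hb : 0 < b) (hu : BrBd b u) (hw : BrBd b w) : BrBd b (fun n x => u n x + w n x) := by
  refine ⟨fun n => (hu.1 n).add (hw.1 n), ?_⟩
  obtain ⟨C, hC⟩ := hu.2
  obtain ⟨D, hD⟩ := hw.2
  refine ⟨2 * C + 2 * D, fun n => ?_⟩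
  have := br_sq_add hb (u := fun _ => u n) (w := fun _ => w n) (hu.1 n) (hw.1 n)
  linarith [hC n, hD n]

theorem BrSm.add (hb : 0 < b) (hu : BrSm b u) (hw : BrSm b w) : BrSm b (fun n x => u n x + w n x) := by
  refine ⟨fun n => (hu.1 n).add (hw.1 n), ?_⟩
  have h := (hu.2.const_mul 2).add (hw.2.const_mul 2)
  simp only [mul_zero, add_zero] at h
  refine squeeze_zero (fun n => br_sq_nonneg hb _) (fun n => ?_) h
  exact br_sq_add hb (u := fun _ => u n) (w := fun _ => w n) (hu.1 n) (hw.1 n)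

theorem br_cmul (hb : 0 < b) {c f : ℝ → ℂ} (hc : ContinuousOn c (Icc 0 b)) (hf : ContinuousOn f (Icc 0 b)) {K : ℝ}
    (hK : ∀ x ∈ Icc 0 b, ‖c x‖ ≤ K) :
    ∫ x in (0 : ℝ)..b, ‖c x * f x‖ ^ 2 ≤ K ^ 2 * ∫ x in (0 : ℝ)..b, ‖f x‖ ^ 2 := by
  rw [← intervalIntegral.integral_const_mul]
  apply intervalIntegral.integral_mono_on hb.le
  · exact br_int hb.le (by fun_prop)
  · exact br_int hb.le (by fun_prop)
  · intro x hx
    rw [norm_mul, mul_pow]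
    have := hK x hx
    gcongr

theorem BrBd.cmul (hb : 0 < b) (hu : BrBd b u) (c : ℝ → ℂ) (hc : ContinuousOn c (Icc 0 b)) :
    BrBd b (fun n x => c x * u n x) := by
  refine ⟨fun n => hc.mul (hu.1 n), ?_⟩
  obtain ⟨C, hC⟩ := hu.2
  obtain ⟨K, hK⟩ := isCompact_Icc.exists_bound_of_continuousOn hc
  refine ⟨K ^ 2 * C, fun n => (br_cmul hb hc (hu.1 n) hK).trans ?_⟩
  have := hC n
  gcongr

theorem BrSm.cmul (hb : 0 < b) (hu : BrSm b u) (c : ℝ → ℂ) (hc : ContinuousOn c (Icc 0 b)) :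
    BrSm b (fun n x => c x * u n x) := by
  refine ⟨fun n => hc.mul (hu.1 n), ?_⟩
  obtain ⟨K, hK⟩ := isCompact_Icc.exists_bound_of_continuousOn hc
  have h := hu.2.const_mul (K ^ 2)
  simp only [mul_zero] at h
  exact squeeze_zero (fun n => br_sq_nonneg hb _) (fun n => br_cmul hb hc (hu.1 n) hK) h

theorem BrBd.sub (hb : 0 < b) (hu : BrBd b u) (hw : BrBd b w) : BrBd b (fun n x => u n x - w n x) := by
  have := hu.add hb (hw.cmul hb (fun _ => -1) continuousOn_const)
  simpa [sub_eq_add_neg] using this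

theorem BrSm.sub (hb : 0 < b) (hu : BrSm b u) (hw : BrSm b w) : BrSm b (fun n x => u n x - w n x) := by
  have := hu.add hb (hw.cmul hb (fun _ => -1) continuousOn_const)
  simpa [sub_eq_add_neg] using this

theorem BrSm.conj (hu : BrSm b u) : BrSm b (fun n x => (starRingEnd ℂ) (u n x)) :=
  ⟨fun n => Complex.continuous_conj.comp_continuousOn (hu.1 n), by simpa using hu.2⟩

theorem BrBd.conj (hu : BrBd b u) : BrBd b (fun n x => (starRingEnd ℂ) (u n x)) :=
  ⟨fun n => Complex.continuous_conj.comp_continuousOn (hu.1 n), by simpa using hu.2⟩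

theorem BrSm.congr (hb : 0 < b) (hu : BrSm b u) (hw : ∀ n, ContinuousOn (w n) (Icc 0 b))
    (h : ∀ n, ∀ x ∈ Ioo 0 b, u n x = w n x) : BrSm b w := by
  refine ⟨hw, ?_⟩
  convert hu.2 using 2 with n
  exact br_congr hb.le (fun x hx => by rw [h n x hx])

theorem BrBd.congr (hb : 0 < b) (hu : BrBd b u) (hw : ∀ n, ContinuousOn (w n) (Icc 0 b))
    (h : ∀ n, ∀ x ∈ Ioo 0 b, u n x = w n x) : BrBd b w := by
  refine ⟨hw, ?_⟩
  obtain ⟨C, hC⟩ := hu.2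
  refine ⟨C, fun n => ?_⟩
  rw [← br_congr hb.le (f := fun x => ‖u n x‖ ^ 2) (fun x hx => by rw [h n x hx])]
  exact hC n

theorem BrNg.congr (hb : 0 < b) (hu : BrNg b u) (hw : ∀ n, ContinuousOn (w n) (Icc 0 b))
    (h : ∀ n, ∀ x ∈ Ioo 0 b, u n x = w n x) : BrNg b w := by
  refine ⟨hw, ?_⟩
  convert hu.2 using 2 with n
  exact br_congr hb.le (fun x hx => by rw [h n x hx])

/-- A bounded sequence times scalars tending to zero. -/
theorem BrBd.small (hb : 0 < b) (hu : BrBd b u) {c : ℕ → ℂ} (hc : Tendsto c atTop (nhds 0)) :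
    BrSm b (fun n x => c n * u n x) := by
  refine ⟨fun n => continuousOn_const.mul (hu.1 n), ?_⟩
  obtain ⟨C, hC⟩ := hu.2
  have h := (hc.norm.pow 2).mul_const C
  simp only [norm_zero, ne_eq, OfNat.ofNat_ne_zero, not_false_eq_true, zero_pow, zero_mul] at h
  refine squeeze_zero (fun n => br_sq_nonneg hb _) (fun n => ?_) h
  refine (br_cmul hb (c := fun _ => c n) continuousOn_const (hu.1 n) (fun x _ => le_rfl)).trans ?_
  have := hC n
  gcongr

/-- The `L²` pairing of a bounded and a small sequence is negligible. -/
theorem BrBd.mul_sm (hb : 0 < b) (hu : BrBd b u) (hw : BrSm b w) : BrNg b (fun n x => u n x * w n x) := by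
  refine ⟨fun n => (hu.1 n).mul (hw.1 n), ?_⟩
  obtain ⟨C, hC⟩ := hu.2
  have hC0 : 0 ≤ C := (br_sq_nonneg hb (u 0)).trans (hC 0)
  rw [Metric.tendsto_atTop]
  intro e he
  set d : ℝ := e / (C + 1) with hd
  have hd0 : 0 < d := by positivity
  obtain ⟨N, hN⟩ := (Metric.tendsto_atTop.1 hw.2) (e * d) (by positivity)
  refine ⟨N, fun n hn => ?_⟩
  have h1 := hN n hn
  rw [Real.dist_eq, sub_zero, abs_of_nonneg (br_sq_nonneg hb _)] at h1
  rw [dist_zero_right]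
  have h2 : ‖∫ x in (0 : ℝ)..b, u n x * w n x‖ ≤ ∫ x in (0 : ℝ)..b,
      (d / 2 * ‖u n x‖ ^ 2 + 1 / (2 * d) * ‖w n x‖ ^ 2) := by
    have cu := hu.1 n
    have cw := hw.1 n
    refine (intervalIntegral.norm_integral_le_integral_norm hb.le).trans ?_
    apply intervalIntegral.integral_mono_on hb.le
    · exact br_int hb.le (by fun_prop)
    · exact br_int hb.le (by fun_prop)
    · intro x _
      rw [norm_mul]
      have : d / 2 * ‖u n x‖ ^ 2 + 1 / (2 * d) * ‖w n x‖ ^ 2 - ‖u n x‖ * ‖w n x‖ =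
        1 / (2 * d) * (d * ‖u n x‖ - ‖w n x‖) ^ 2 := by field_simp; ring
      have h3 : 0 ≤ 1 / (2 * d) * (d * ‖u n x‖ - ‖w n x‖) ^ 2 := by positivity
      linarith
  have cu := hu.1 n
  have cw := hw.1 n
  rw [intervalIntegral.integral_add (br_int hb.le (by fun_prop)) (br_int hb.le (by fun_prop)),
    intervalIntegral.integral_const_mul, intervalIntegral.integral_const_mul] at h2
  refine h2.trans_lt ?_
  have h4 : d / 2 * ∫ x in (0 : ℝ)..b, ‖u n x‖ ^ 2 ≤ d / 2 * C := by
    have := hC n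
    gcongr
  have h5 : 1 / (2 * d) * ∫ x in (0 : ℝ)..b, ‖w n x‖ ^ 2 < 1 / (2 * d) * (e * d) := by
    gcongr
  have h6 : 1 / (2 * d) * (e * d) = e / 2 := by field_simp
  have h7 : d * (C + 1) = e := by rw [hd]; field_simp
  nlinarith

theorem BrSm.mul_bd (hb : 0 < b) (hu : BrSm b u) (hw : BrBd b w) : BrNg b (fun n x => u n x * w n x) := by
  have := hw.mul_sm hb hu
  simpa only [mul_comm] using this

theorem BrNg.add (hb : 0 < b) (hu : BrNg b u) (hw : BrNg b w) : BrNg b (fun n x => u n x + w n x) := by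
  refine ⟨fun n => (hu.1 n).add (hw.1 n), ?_⟩
  have h := hu.2.add hw.2
  rw [add_zero] at h
  convert h using 2 with n
  exact intervalIntegral.integral_add (br_int hb.le (hu.1 n)) (br_int hb.le (hw.1 n))

theorem BrNg.sub (hb : 0 < b) (hu : BrNg b u) (hw : BrNg b w) : BrNg b (fun n x => u n x - w n x) := by
  refine ⟨fun n => (hu.1 n).sub (hw.1 n), ?_⟩
  have h := hu.2.sub hw.2
  rw [sub_zero] at h
  convert h using 2 with n
  exact intervalIntegral.integral_sub (br_int hb.le (hu.1 n)) (br_int hb.le (hw.1 n))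

theorem BrNg.cmul (hu : BrNg b u) (c : ℂ) : BrNg b (fun n x => c * u n x) := by
  refine ⟨fun n => continuousOn_const.mul (hu.1 n), ?_⟩
  have h := hu.2.const_mul c
  rw [mul_zero] at h
  convert h using 2 with n
  exact intervalIntegral.integral_const_mul _ _

theorem BrNg.sm (hc : ∀ n, ContinuousOn (u n) (Icc 0 b))
    (hu : BrNg b (fun n x => u n x * (starRingEnd ℂ) (u n x))) : BrSm b u := by
  refine ⟨hc, ?_⟩
  have h := (Complex.continuous_re.tendsto _).comp hu.2
  simp only [Complex.zero_re] at h
  convert h using 2 with n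
  have : ∀ x, u n x * (starRingEnd ℂ) (u n x) = ((‖u n x‖ ^ 2 : ℝ) : ℂ) := fun x => by
    rw [Complex.mul_conj, Complex.normSq_eq_norm_sq]
  simp only [this, Function.comp, intervalIntegral.integral_ofReal, Complex.ofReal_re]

/-- The polynomial weight, vanishing at both ends of `[0,b]`. -/
def brp (b : ℝ) (x : ℝ) : ℂ := ((x * (b - x) : ℝ) : ℂ)
/-- The derivative of the weight. -/
def brq (b : ℝ) (x : ℝ) : ℂ := ((b - 2 * x : ℝ) : ℂ)

theorem brp_deriv (x : ℝ) : HasDerivAt (brp b) (brq b x) x := by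
  have h1 := (hasDerivAt_id' x).fun_mul ((hasDerivAt_id' x).const_sub b)
  have : HasDerivAt (fun x : ℝ => x * (b - x)) (b - 2 * x) x := h1.congr_deriv (by ring)
  exact this.ofReal_comp

@[fun_prop]
theorem brp_cont : Continuous (brp b) := by unfold brp; fun_prop
@[fun_prop]
theorem brq_cont : Continuous (brq b) := by unfold brq; fun_prop
theorem brp_conj (x : ℝ) : (starRingEnd ℂ) (brp b x) = brp b x := Complex.conj_ofReal _

theorem br_dconj {c : ℝ → ℂ} {c' : ℂ} {x : ℝ} (h : HasDerivAt c c' x) :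
    HasDerivAt (fun x => (starRingEnd ℂ) (c x)) ((starRingEnd ℂ) c') x := h.star

/-- Weighted integration by parts. -/
theorem br_ibp (hb : 0 < b) {a a' c c' : ℕ → ℝ → ℂ} (ha : ∀ n, ContinuousOn (a n) (Icc 0 b))
    (ha' : ∀ n, ContinuousOn (a' n) (Icc 0 b)) (hc : ∀ n, ContinuousOn (c n) (Icc 0 b))
    (hc' : ∀ n, ContinuousOn (c' n) (Icc 0 b))
    (da : ∀ n, ∀ x ∈ Ioo 0 b, HasDerivAt (a n) (a' n x) x)
    (dc : ∀ n, ∀ x ∈ Ioo 0 b, HasDerivAt (c n) (c' n x) x) :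
    BrNg b (fun n x => 2 * brp b x * brq b x * (a n x * (starRingEnd ℂ) (c n x))
      + brp b x ^ 2 * (a' n x * (starRingEnd ℂ) (c n x) + a n x * (starRingEnd ℂ) (c' n x))) := by
  have cc : ∀ n, ContinuousOn (fun x => (starRingEnd ℂ) (c n x)) (Icc 0 b) :=
    fun n => Complex.continuous_conj.comp_continuousOn (hc n)
  have cc' : ∀ n, ContinuousOn (fun x => (starRingEnd ℂ) (c' n x)) (Icc 0 b) :=
    fun n => Complex.continuous_conj.comp_continuousOn (hc' n)
  have hcont : ∀ n, ContinuousOn (fun x => 2 * brp b x * brq b x * (a n x * (starRingEnd ℂ) (c n x))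
      + brp b x ^ 2 * (a' n x * (starRingEnd ℂ) (c n x) + a n x * (starRingEnd ℂ) (c' n x)))
      (Icc 0 b) := by
    intro n
    have := ha n; have := ha' n; have := cc n; have := cc' n
    fun_prop
  refine ⟨hcont, ?_⟩
  have : ∀ n, (∫ x in (0:ℝ)..b, (2 * brp b x * brq b x * (a n x * (starRingEnd ℂ) (c n x))
      + brp b x ^ 2 * (a' n x * (starRingEnd ℂ) (c n x) + a n x * (starRingEnd ℂ) (c' n x)))) = 0 := by
    intro n
    rw [intervalIntegral.integral_eq_sub_of_hasDerivAt_of_le hb.le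
      (f := fun x => brp b x ^ 2 * (a n x * (starRingEnd ℂ) (c n x))) ?_ ?_
      (br_int hb.le (hcont n))]
    · simp [brp]
    · have := ha n; have := cc n
      fun_prop
    · intro x hx
      have h1 := ((brp_deriv (b := b) x).fun_pow 2).fun_mul
        ((da n x hx).fun_mul (br_dconj (dc n x hx)))
      exact h1.congr_deriv (by simp)
  simp only [this]
  exact tendsto_const_nhds

end calculus


theorem br_lam {b : ℝ} (hb : 0 < b) {lam : ℕ → ℝ} {v w f : ℕ → ℝ → ℂ}
    (cv : ∀ n, ContinuousOn (v n) (Icc 0 b))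
    (E : ∀ n, ∀ x ∈ Ioo 0 b, Complex.I * (lam n : ℂ) * v n x - w n x = f n x)
    (hw : BrBd b w) (hf : BrBd b f) : BrBd b (fun n x => (lam n : ℂ) * v n x) := by
  refine ((hw.add hb hf).cmul hb (fun _ => -Complex.I) continuousOn_const).congr hb
    (fun n => continuousOn_const.mul (cv n)) (fun n x hx => ?_)
  rw [← E n x hx]
  linear_combination (-(lam n : ℂ) * v n x) * Complex.I_mul_I

theorem br_lam' {b : ℝ} (hb : 0 < b) {lam : ℕ → ℝ} {v w f : ℕ → ℝ → ℂ}
    (cv : ∀ n, ContinuousOn (v n) (Icc 0 b))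
    (E : ∀ n, ∀ x ∈ Ioo 0 b, Complex.I * (lam n : ℂ) * v n x - w n x = f n x)
    (hw : BrSm b w) (hf : BrSm b f) : BrSm b (fun n x => (lam n : ℂ) * v n x) := by
  refine ((hw.add hb hf).cmul hb (fun _ => -Complex.I) continuousOn_const).congr hb
    (fun n => continuousOn_const.mul (cv n)) (fun n x hx => ?_)
  rw [← E n x hx]
  linear_combination (-(lam n : ℂ) * v n x) * Complex.I_mul_I

theorem br_unlam {b : ℝ} (hb : 0 < b) {lam : ℕ → ℝ} (h0 : ∀ n, lam n ≠ 0)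
    (hl : Tendsto (fun n => |lam n|) atTop atTop) {v : ℕ → ℝ → ℂ}
    (cv : ∀ n, ContinuousOn (v n) (Icc 0 b))
    (h : BrBd b (fun n x => (lam n : ℂ) * v n x)) : BrSm b v := by
  have hc : Tendsto (fun n => ((lam n : ℂ))⁻¹) atTop (nhds 0) := by
    rw [tendsto_zero_iff_norm_tendsto_zero]
    simpa [Function.comp_def] using tendsto_inv_atTop_zero.comp hl
  refine (h.small hb hc).congr hb cv (fun n x _ => ?_)
  have : (lam n : ℂ) ≠ 0 := by exact_mod_cast h0 n
  field_simp

set_option maxHeartbeats 1000000 in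
/-- The multiplier argument on the damped region. -/
theorem br_core {b ρ k l a₀ : ℝ} (hb : 0 < b) (hρ : 0 < ρ) (hk : 0 < k) (hl : 0 < l)
    {lam : ℕ → ℝ} (h0 : ∀ n, lam n ≠ 0) (hlam : Tendsto (fun n => |lam n|) atTop atTop)
    {v1 v2 v3 v4 v5 v6 d1 d3 d5 f1 f2 f3 f5 f6 g1 g5 : ℕ → ℝ → ℂ}
    (hv2 : BrBd b v2) (hv4 : BrBd b v4) (hv6 : BrSm b v6)
    (hS1 : BrBd b (fun n x => d1 n x + v3 n x + (l : ℂ) * v5 n x)) (hd3 : BrBd b d3)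
    (hS3 : BrBd b (fun n x => d5 n x - (l : ℂ) * v1 n x))
    (hf1 : BrSm b f1) (hf2 : BrSm b f2) (hf3 : BrSm b f3) (hf5 : BrSm b f5) (hf6 : BrSm b f6)
    (hg1 : BrSm b g1) (hg5 : BrSm b g5)
    (cv1 : ∀ n, ContinuousOn (v1 n) (Icc 0 b)) (cv3 : ∀ n, ContinuousOn (v3 n) (Icc 0 b))
    (cv5 : ∀ n, ContinuousOn (v5 n) (Icc 0 b)) (cd1 : ∀ n, ContinuousOn (d1 n) (Icc 0 b))
    (cd5 : ∀ n, ContinuousOn (d5 n) (Icc 0 b))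
    (Dv1 : ∀ n, ∀ x ∈ Ioo 0 b, HasDerivAt (v1 n) (d1 n x) x)
    (Dv3 : ∀ n, ∀ x ∈ Ioo 0 b, HasDerivAt (v3 n) (d3 n x) x)
    (Dv5 : ∀ n, ∀ x ∈ Ioo 0 b, HasDerivAt (v5 n) (d5 n x) x)
    (Df1 : ∀ n, ∀ x ∈ Ioo 0 b, HasDerivAt (f1 n) (g1 n x) x)
    (Df5 : ∀ n, ∀ x ∈ Ioo 0 b, HasDerivAt (f5 n) (g5 n x) x)
    (E1 : ∀ n, ∀ x ∈ Ioo 0 b, Complex.I * (lam n : ℂ) * v1 n x - v2 n x = f1 n x)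
    (E3 : ∀ n, ∀ x ∈ Ioo 0 b, Complex.I * (lam n : ℂ) * v3 n x - v4 n x = f3 n x)
    (E5 : ∀ n, ∀ x ∈ Ioo 0 b, Complex.I * (lam n : ℂ) * v5 n x - v6 n x = f5 n x)
    (D1 : ∀ n, ∀ x ∈ Ioo 0 b, HasDerivAt (d1 n) ((k : ℂ)⁻¹ * (Complex.I * (lam n : ℂ) * ρ * v2 n x
      - k * d3 n x - k * l * d5 n x - l * k * (d5 n x - l * v1 n x) - ρ * f2 n x)) x)
    (D5 : ∀ n, ∀ x ∈ Ioo 0 b, HasDerivAt (d5 n) ((k : ℂ)⁻¹ * (Complex.I * (lam n : ℂ) * ρ * v6 n x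
      + k * l * d1 n x + l * k * (d1 n x + v3 n x + l * v5 n x) + a₀ * v6 n x - ρ * f6 n x)) x) :
    BrSm b (fun n x => brp b x * d1 n x) ∧
      BrSm b (fun n x => brp b x * ((lam n : ℂ) * v1 n x)) := by
  have hkC : (k : ℂ) ≠ 0 := by exact_mod_cast hk.ne'
  have hρC : (ρ : ℂ) ≠ 0 := by exact_mod_cast hρ.ne'
  have hlC : (l : ℂ) ≠ 0 := by exact_mod_cast hl.ne'
  have hlv1 := br_lam hb cv1 E1 hv2 hf1.bd
  have hlv3 := br_lam hb cv3 E3 hv4 hf3.bd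
  have hlv5 := br_lam' hb cv5 E5 hv6 hf5
  have hv1 := br_unlam hb h0 hlam cv1 hlv1
  have hv3 := br_unlam hb h0 hlam cv3 hlv3
  have hv5 := br_unlam hb h0 hlam cv5 hlv5.bd
  have hd5 : BrBd b d5 := (hS3.add hb (hv1.bd.cmul hb (fun _ => (l : ℂ)) continuousOn_const)).congr
    hb cd5 (fun n x _ => by ring)
  have hd1 : BrBd b d1 := ((hS1.sub hb hv3.bd).sub hb
    (hv5.bd.cmul hb (fun _ => (l : ℂ)) continuousOn_const)).congr
    hb cd1 (fun n x _ => by ring)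
  have cv2 := hv2.1
  have cv6 := hv6.1
  have cd3 := hd3.1
  have cf1 := hf1.1
  have cf2 := hf2.1
  have cf5 := hf5.1
  have cf6 := hf6.1
  have cg1 := hg1.1
  have cg5 := hg5.1
  have cc : ∀ {u : ℕ → ℝ → ℂ}, (∀ n, ContinuousOn (u n) (Icc 0 b)) →
      ∀ n, ContinuousOn (fun x => (starRingEnd ℂ) (u n x)) (Icc 0 b) :=
    fun h n => Complex.continuous_conj.comp_continuousOn (h n)
  -- first step: the derivative of `v5`
  have hpd5 : BrSm b (fun n x => brp b x * d5 n x) := by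
    have N0 := br_ibp hb (a := fun n x => (k : ℂ) * (d5 n x - l * v1 n x)) (c := v5)
      (a' := fun n x => Complex.I * (lam n : ℂ) * ρ * v6 n x
      + l * k * (d1 n x + v3 n x + l * v5 n x) + a₀ * v6 n x - ρ * f6 n x) (c' := d5)
      (fun n => by have := cd5 n; have := cv1 n; fun_prop)
      (fun n => by have := cv6 n; have := cd1 n; have := cv3 n; have := cv5 n; have := cf6 n
                   fun_prop)
      cv5 cd5
      (fun n x hx => (((D5 n x hx).sub ((Dv1 n x hx).const_mul (l : ℂ))).const_mul
        (k : ℂ)).congr_deriv (by field_simp; ring))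
      Dv5
    have N1 := BrBd.mul_sm hb (((hS3.cmul hb (fun x => 2 * brp b x * brq b x * k) (by fun_prop)).add hb
      (hS1.cmul hb (fun x => brp b x ^ 2 * (l * k)) (by fun_prop))).add hb
      ((hv6.bd.cmul hb (fun x => brp b x ^ 2 * a₀) (by fun_prop)).sub hb
      (hf6.bd.cmul hb (fun x => brp b x ^ 2 * ρ) (by fun_prop)))) hv5.conj
    have N2 := (hv6.cmul hb (fun x => brp b x ^ 2 * (Complex.I * ρ)) (by fun_prop)).mul_bd hb
      hlv5.bd.conj
    have N3 := (hv1.cmul hb (fun x => brp b x ^ 2 * (k * l)) (by fun_prop)).mul_bd hb hd5.conj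
    have cp : ∀ n, ContinuousOn (fun x => brp b x * d5 n x) (Icc 0 b) :=
      fun n => by have := cd5 n; fun_prop
    refine BrNg.sm cp ((((((N0.sub hb N1).sub hb N2).add hb N3).cmul (k : ℂ)⁻¹)).congr hb
      (fun n => (cp n).mul (cc cp n)) (fun n x hx => ?_))
    simp only [map_mul, brp_conj, Complex.conj_ofReal]
    field_simp
    ring
  -- second step: the derivative of `v1`
  have hpd1 : BrSm b (fun n x => brp b x * d1 n x) := by
    have cw1 : ∀ n, ContinuousOn (fun x => (k : ℂ)⁻¹ * (Complex.I * (lam n : ℂ) * ρ * v2 n x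
      - k * d3 n x - k * l * d5 n x - l * k * (d5 n x - l * v1 n x) - ρ * f2 n x)) (Icc 0 b) :=
      fun n => by
        have := cv2 n; have := cd3 n; have := cv1 n; have := cd5 n; have := cf2 n
        fun_prop
    have cw5 : ∀ n, ContinuousOn (fun x => (k : ℂ)⁻¹ * (Complex.I * (lam n : ℂ) * ρ * v6 n x
      + k * l * d1 n x + l * k * (d1 n x + v3 n x + l * v5 n x) + a₀ * v6 n x - ρ * f6 n x))
      (Icc 0 b) := fun n => by
        have := cv6 n; have := cd1 n; have := cv3 n; have := cv5 n; have := cf6 n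
        fun_prop
    have M0 := br_ibp hb cd5 cw5 cd1 cw1 D5 D1
    have M1 := br_ibp hb (a := fun n x => (lam n : ℂ) ^ 2 * v5 n x)
      (a' := fun n x => (lam n : ℂ) ^ 2 * d5 n x)
      (fun n => continuousOn_const.mul (cv5 n)) (fun n => continuousOn_const.mul (cd5 n)) cv1 cd1
      (fun n x hx => (Dv5 n x hx).const_mul _) Dv1
    have M2 := br_ibp hb (a := fun n x => (Complex.I * lam n : ℂ) * v5 n x)
      (a' := fun n x => (Complex.I * lam n : ℂ) * d5 n x)
      (fun n => continuousOn_const.mul (cv5 n)) (fun n => continuousOn_const.mul (cd5 n)) cf1 cg1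
      (fun n x hx => (Dv5 n x hx).const_mul _) Df1
    have M3 := br_ibp hb (a := fun n x => (Complex.I * lam n : ℂ) * f5 n x)
      (a' := fun n x => (Complex.I * lam n : ℂ) * g5 n x)
      (fun n => continuousOn_const.mul (cf5 n)) (fun n => continuousOn_const.mul (cg5 n)) cv1 cd1
      (fun n x hx => (Df5 n x hx).const_mul _) Dv1
    -- remainder terms
    have R1 := (hpd5.cmul hb (fun x => 2 * brq b x * k) (by fun_prop)).mul_bd hb hd1.conj
    have hB : BrBd b (fun n x => (k : ℂ) * d3 n x + k * l * d5 n x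
        + l * k * (d5 n x - l * v1 n x) + ρ * f2 n x) :=
      (((hd3.cmul hb (fun _ => (k : ℂ)) continuousOn_const).add hb
        (hd5.cmul hb (fun _ => (k * l : ℂ)) continuousOn_const)).add hb
        (hS3.cmul hb (fun _ => (l * k : ℂ)) continuousOn_const)).add hb
        (hf2.bd.cmul hb (fun _ => (ρ : ℂ)) continuousOn_const)
    have R2 := (hpd5.cmul hb (fun x => brp b x) (by fun_prop)).mul_bd hb hB.conj
    have R3 := (hlv5.cmul hb (fun x => 2 * brp b x * brq b x * ρ) (by fun_prop)).mul_bd hb hlv1.conj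
    have R4 := (hlv5.cmul hb (fun x => 2 * brp b x * brq b x * (Complex.I * ρ))
      (by fun_prop)).mul_bd hb hf1.bd.conj
    have R5 := (hlv5.cmul hb (fun x => brp b x ^ 2 * (Complex.I * ρ))
      (by fun_prop)).mul_bd hb hg1.bd.conj
    have R6 := (hf5.cmul hb (fun x => 2 * brp b x * brq b x * (Complex.I * ρ))
      (by fun_prop)).mul_bd hb hlv1.conj
    have R7 := (hg5.cmul hb (fun x => brp b x ^ 2 * (Complex.I * ρ))
      (by fun_prop)).mul_bd hb hlv1.conj
    have R8 := (((hv3.add hb (hv5.cmul hb (fun _ => (l : ℂ)) continuousOn_const)).cmul hb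
      (fun x => brp b x ^ 2 * (l * k)) (by fun_prop)).add hb
      ((hv6.cmul hb (fun x => brp b x ^ 2 * a₀) (by fun_prop)).sub hb
      (hf6.cmul hb (fun x => brp b x ^ 2 * ρ) (by fun_prop)))).mul_bd hb hd1.conj
    have cp : ∀ n, ContinuousOn (fun x => brp b x * d1 n x) (Icc 0 b) :=
      fun n => by have := cd1 n; fun_prop
    have T := (((M0.cmul (k : ℂ)).add hb (M1.cmul (ρ : ℂ))).sub hb (M2.cmul (ρ : ℂ))).add hb
      (M3.cmul (ρ : ℂ))
    have R := (((((((R1.sub hb R2).add hb R3).sub hb R4).sub hb R5).add hb R6).add hb R7).add hb R8)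
    refine BrNg.sm cp (((T.sub hb R).cmul (2 * l * k : ℂ)⁻¹).congr hb
      (fun n => (cp n).mul (cc cp n)) (fun n x hx => ?_))
    have e2 : v2 n x = Complex.I * (lam n : ℂ) * v1 n x - f1 n x := by rw [← E1 n x hx]; ring
    have e6 : v6 n x = Complex.I * (lam n : ℂ) * v5 n x - f5 n x := by rw [← E5 n x hx]; ring
    simp only [map_mul, map_sub, map_add, map_inv₀, brp_conj, Complex.conj_ofReal, Complex.conj_I,
      e2, e6]
    field_simp
    ring_nf
    simp only [Complex.I_sq]
    ring
  refine ⟨hpd1, ?_⟩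
  have N0 := br_ibp hb (a := fun n x => (k : ℂ) * (d1 n x + v3 n x + l * v5 n x)) (c := v1)
      (a' := fun n x => Complex.I * (lam n : ℂ) * ρ * v2 n x
        - l * k * (d5 n x - l * v1 n x) - ρ * f2 n x) (c' := d1)
      (fun n => by have := cd1 n; have := cv3 n; have := cv5 n; fun_prop)
      (fun n => by have := cv2 n; have := cd5 n; have := cv1 n; have := cf2 n
                   fun_prop)
      cv1 cd1
      (fun n x hx => ((((D1 n x hx).add (Dv3 n x hx)).add
        ((Dv5 n x hx).const_mul (l : ℂ))).const_mul (k : ℂ)).congr_deriv (by field_simp; ring))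
      Dv1
  have N1 := BrBd.mul_sm hb ((hS1.cmul hb (fun x => 2 * brp b x * brq b x * k) (by fun_prop)).sub hb
      ((hS3.cmul hb (fun x => brp b x ^ 2 * (l * k)) (by fun_prop)).add hb
      (hf2.bd.cmul hb (fun x => brp b x ^ 2 * ρ) (by fun_prop)))) hv1.conj
  have N2 := (hf1.cmul hb (fun x => brp b x ^ 2 * (Complex.I * ρ)) (by fun_prop)).mul_bd hb
      hlv1.conj
  have N3 := (hS1.cmul hb (fun x => brp b x * k) (by fun_prop)).mul_sm hb hpd1.conj
  have cp : ∀ n, ContinuousOn (fun x => brp b x * ((lam n : ℂ) * v1 n x)) (Icc 0 b) :=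
    fun n => by have := cv1 n; fun_prop
  refine BrNg.sm cp (((((N1.sub hb N2).add hb N3).sub hb N0).cmul (ρ : ℂ)⁻¹).congr hb
      (fun n => (cp n).mul (cc cp n)) (fun n x hx => ?_))
  have e2 : v2 n x = Complex.I * (lam n : ℂ) * v1 n x - f1 n x := by rw [← E1 n x hx]; ring
  simp only [map_mul, brp_conj, Complex.conj_ofReal, e2]
  field_simp
  ring_nf
  simp only [Complex.I_sq]
  ring


theorem br_young {d : ℝ} (hd : 0 < d) (x y : ℂ) :
    (x * (starRingEnd ℂ) y).re ≤ d / 2 * ‖y‖ ^ 2 + 1 / (2 * d) * ‖x‖ ^ 2 := by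
  have h1 : (x * (starRingEnd ℂ) y).re ≤ ‖x‖ * ‖y‖ := by
    refine (Complex.re_le_norm _).trans ?_
    simp
  have : d / 2 * ‖y‖ ^ 2 + 1 / (2 * d) * ‖x‖ ^ 2 - ‖x‖ * ‖y‖ =
    1 / (2 * d) * (d * ‖y‖ - ‖x‖) ^ 2 := by field_simp; ring
  have h3 : 0 ≤ 1 / (2 * d) * (d * ‖y‖ - ‖x‖) ^ 2 := by positivity
  linarith

/-- The pointwise energy density. -/
def brE (ρ₁ ρ₂ k₁ k₂ k₃ : ℝ) (s1 v2 d3 v4 s3 v6 : ℂ) : ℝ :=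
  k₁ * ‖s1‖ ^ 2 + ρ₁ * ‖v2‖ ^ 2 + k₂ * ‖d3‖ ^ 2 + ρ₂ * ‖v4‖ ^ 2 + k₃ * ‖s3‖ ^ 2 + ρ₁ * ‖v6‖ ^ 2

/-- The energy flux. -/
def brG (k₁ k₂ k₃ : ℝ) (s1 v2 d3 v4 s3 v6 : ℂ) : ℝ :=
  (k₁ * s1 * (starRingEnd ℂ) v2 + k₂ * d3 * (starRingEnd ℂ) v4 + k₃ * s3 * (starRingEnd ℂ) v6).re

set_option maxHeartbeats 1000000 in
/-- The energy inequality on a subinterval. -/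
theorem br_flux {s t ρ₁ ρ₂ k₁ k₂ k₃ l a lam δ : ℝ} (hst : s < t)
    (hrho1 : 0 < ρ₁) (hrho2 : 0 < ρ₂) (hk1 : 0 < k₁) (hk2 : 0 < k₂) (hk3 : 0 < k₃) (hδ : 0 < δ)
    {v1 v2 v3 v4 v5 v6 d1 d3 d5 f1 f2 f3 f4 f5 f6 g1 g3 g5 : ℝ → ℂ}
    (cv1 : ContinuousOn v1 (Icc s t)) (cv2 : ContinuousOn v2 (Icc s t))
    (cv3 : ContinuousOn v3 (Icc s t)) (cv4 : ContinuousOn v4 (Icc s t))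
    (cv5 : ContinuousOn v5 (Icc s t)) (cv6 : ContinuousOn v6 (Icc s t))
    (cd1 : ContinuousOn d1 (Icc s t)) (cd3 : ContinuousOn d3 (Icc s t))
    (cd5 : ContinuousOn d5 (Icc s t))
    (cf1 : ContinuousOn f1 (Icc s t)) (cf2 : ContinuousOn f2 (Icc s t))
    (cf3 : ContinuousOn f3 (Icc s t)) (cf4 : ContinuousOn f4 (Icc s t))
    (cf5 : ContinuousOn f5 (Icc s t)) (cf6 : ContinuousOn f6 (Icc s t))
    (cg1 : ContinuousOn g1 (Icc s t)) (cg3 : ContinuousOn g3 (Icc s t))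
    (cg5 : ContinuousOn g5 (Icc s t))
    (E1 : ∀ x ∈ Ioo s t, Complex.I * (lam : ℂ) * v1 x - v2 x = f1 x)
    (E3 : ∀ x ∈ Ioo s t, Complex.I * (lam : ℂ) * v3 x - v4 x = f3 x)
    (E5 : ∀ x ∈ Ioo s t, Complex.I * (lam : ℂ) * v5 x - v6 x = f5 x)
    (Dv2 : ∀ x ∈ Ioo s t, HasDerivAt v2 (Complex.I * (lam : ℂ) * d1 x - g1 x) x)
    (Dv4 : ∀ x ∈ Ioo s t, HasDerivAt v4 (Complex.I * (lam : ℂ) * d3 x - g3 x) x)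
    (Dv6 : ∀ x ∈ Ioo s t, HasDerivAt v6 (Complex.I * (lam : ℂ) * d5 x - g5 x) x)
    (DS1 : ∀ x ∈ Ioo s t, HasDerivAt (fun x => d1 x + v3 x + l * v5 x)
      ((k₁ : ℂ)⁻¹ * (Complex.I * (lam : ℂ) * ρ₁ * v2 x - l * k₃ * (d5 x - l * v1 x)
        - ρ₁ * f2 x)) x)
    (Dd3 : ∀ x ∈ Ioo s t, HasDerivAt d3
      ((k₂ : ℂ)⁻¹ * (Complex.I * (lam : ℂ) * ρ₂ * v4 x + k₁ * (d1 x + v3 x + l * v5 x)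
        - ρ₂ * f4 x)) x)
    (DS3 : ∀ x ∈ Ioo s t, HasDerivAt (fun x => d5 x - l * v1 x)
      ((k₃ : ℂ)⁻¹ * (Complex.I * (lam : ℂ) * ρ₁ * v6 x + l * k₁ * (d1 x + v3 x + l * v5 x)
        + a * v6 x - ρ₁ * f6 x)) x) :
    a * ∫ x in s..t, ‖v6 x‖ ^ 2 ≤
      brG k₁ k₂ k₃ (d1 t + v3 t + l * v5 t) (v2 t) (d3 t) (v4 t) (d5 t - l * v1 t) (v6 t)
      - brG k₁ k₂ k₃ (d1 s + v3 s + l * v5 s) (v2 s) (d3 s) (v4 s) (d5 s - l * v1 s) (v6 s)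
      + (δ / 2 * (∫ x in s..t, brE ρ₁ ρ₂ k₁ k₂ k₃ (d1 x + v3 x + l * v5 x) (v2 x) (d3 x) (v4 x)
          (d5 x - l * v1 x) (v6 x))
        + 1 / (2 * δ) * ∫ x in s..t, brE ρ₁ ρ₂ k₁ k₂ k₃ (g1 x + f3 x + l * f5 x) (f2 x) (g3 x) (f4 x)
          (g5 x - l * f1 x) (f6 x)) := by
  have hk1C : (k₁ : ℂ) ≠ 0 := by exact_mod_cast hk1.ne'
  have hk2C : (k₂ : ℂ) ≠ 0 := by exact_mod_cast hk2.ne'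
  have hk3C : (k₃ : ℂ) ≠ 0 := by exact_mod_cast hk3.ne'
  set P : ℝ → ℝ := fun x =>
    k₁ * ((g1 x + f3 x + l * f5 x) * (starRingEnd ℂ) (d1 x + v3 x + l * v5 x)).re
    + ρ₁ * (f2 x * (starRingEnd ℂ) (v2 x)).re
    + k₂ * (g3 x * (starRingEnd ℂ) (d3 x)).re
    + ρ₂ * (f4 x * (starRingEnd ℂ) (v4 x)).re
    + k₃ * ((g5 x - l * f1 x) * (starRingEnd ℂ) (d5 x - l * v1 x)).re
    + ρ₁ * (f6 x * (starRingEnd ℂ) (v6 x)).re with hP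
  have cc : ∀ {u : ℝ → ℂ}, ContinuousOn u (Icc s t) →
      ContinuousOn (fun x => (starRingEnd ℂ) (u x)) (Icc s t) :=
    fun h => Complex.continuous_conj.comp_continuousOn h
  have cre : ∀ {u : ℝ → ℂ}, ContinuousOn u (Icc s t) →
      ContinuousOn (fun x => (u x).re) (Icc s t) :=
    fun h => Complex.continuous_re.comp_continuousOn h
  have cS1 : ContinuousOn (fun x => d1 x + v3 x + l * v5 x) (Icc s t) := by fun_prop
  have cS3 : ContinuousOn (fun x => d5 x - l * v1 x) (Icc s t) := by fun_prop
  have cP : ContinuousOn P (Icc s t) := by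
    have h1 := cre (u := fun x => (g1 x + f3 x + l * f5 x) *
      (starRingEnd ℂ) (d1 x + v3 x + l * v5 x)) (ContinuousOn.mul (by fun_prop) (cc cS1))
    have h2 := cre (cf2.mul (cc cv2))
    have h3 := cre (cg3.mul (cc cd3))
    have h4 := cre (cf4.mul (cc cv4))
    have h5 := cre (u := fun x => (g5 x - l * f1 x) * (starRingEnd ℂ) (d5 x - l * v1 x))
      (ContinuousOn.mul (by fun_prop) (cc cS3))
    have h6 := cre (cf6.mul (cc cv6))
    exact (((((continuousOn_const.mul h1).add (continuousOn_const.mul h2)).add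
      (continuousOn_const.mul h3)).add (continuousOn_const.mul h4)).add
      (continuousOn_const.mul h5)).add (continuousOn_const.mul h6)
  have key : ∫ x in s..t, (a * ‖v6 x‖ ^ 2 - P x) =
      brG k₁ k₂ k₃ (d1 t + v3 t + l * v5 t) (v2 t) (d3 t) (v4 t) (d5 t - l * v1 t) (v6 t)
      - brG k₁ k₂ k₃ (d1 s + v3 s + l * v5 s) (v2 s) (d3 s) (v4 s) (d5 s - l * v1 s) (v6 s) := by
    apply intervalIntegral.integral_eq_sub_of_hasDerivAt_of_le hst.le
      (f := fun x => brG k₁ k₂ k₃ (d1 x + v3 x + l * v5 x) (v2 x) (d3 x) (v4 x)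
        (d5 x - l * v1 x) (v6 x))
    · unfold brG
      apply cre
      exact (((continuousOn_const.mul cS1).mul (cc cv2)).add
        ((continuousOn_const.mul cd3).mul (cc cv4))).add ((continuousOn_const.mul cS3).mul (cc cv6))
    · intro x hx
      unfold brG
      have h1 := ((((DS1 x hx).const_mul (k₁ : ℂ)).fun_mul (br_dconj (Dv2 x hx))).fun_add
        (((Dd3 x hx).const_mul (k₂ : ℂ)).fun_mul (br_dconj (Dv4 x hx)))).fun_add
        (((DS3 x hx).const_mul (k₃ : ℂ)).fun_mul (br_dconj (Dv6 x hx)))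
      have h2 := (Complex.reCLM.hasFDerivAt.comp_hasDerivAt x h1)
      refine HasDerivAt.congr_deriv h2 ?_
      have e2 : v2 x = Complex.I * (lam : ℂ) * v1 x - f1 x := by rw [← E1 x hx]; ring
      have e4 : v4 x = Complex.I * (lam : ℂ) * v3 x - f3 x := by rw [← E3 x hx]; ring
      have e6 : v6 x = Complex.I * (lam : ℂ) * v5 x - f5 x := by rw [← E5 x hx]; ring
      rw [hP]
      simp only [Complex.reCLM_apply]
      have nn : ∀ z : ℂ, ‖z‖ ^ 2 = z.re * z.re + z.im * z.im := fun z => by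
        rw [Complex.sq_norm, Complex.normSq_apply]
      rw [nn]
      rw [mul_inv_cancel_left₀ hk1C, mul_inv_cancel_left₀ hk2C, mul_inv_cancel_left₀ hk3C]
      simp only [e2, e4, e6, Complex.add_re, Complex.sub_re, Complex.mul_re, Complex.add_im,
        Complex.sub_im, Complex.mul_im, Complex.conj_re, Complex.conj_im, Complex.ofReal_re,
        Complex.ofReal_im, Complex.I_re, Complex.I_im]
      ring
    · exact br_int hst.le (by fun_prop)
  have cU : ContinuousOn (fun x => brE ρ₁ ρ₂ k₁ k₂ k₃ (d1 x + v3 x + l * v5 x) (v2 x) (d3 x) (v4 x)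
          (d5 x - l * v1 x) (v6 x)) (Icc s t) := by unfold brE; fun_prop
  have cF : ContinuousOn (fun x => brE ρ₁ ρ₂ k₁ k₂ k₃ (g1 x + f3 x + l * f5 x) (f2 x) (g3 x) (f4 x)
          (g5 x - l * f1 x) (f6 x)) (Icc s t) := by unfold brE; fun_prop
  have hPle : ∫ x in s..t, P x ≤ δ / 2 * (∫ x in s..t, brE ρ₁ ρ₂ k₁ k₂ k₃ (d1 x + v3 x + l * v5 x)
          (v2 x) (d3 x) (v4 x) (d5 x - l * v1 x) (v6 x))
        + 1 / (2 * δ) * ∫ x in s..t, brE ρ₁ ρ₂ k₁ k₂ k₃ (g1 x + f3 x + l * f5 x) (f2 x) (g3 x) (f4 x)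
          (g5 x - l * f1 x) (f6 x) := by
    rw [← intervalIntegral.integral_const_mul, ← intervalIntegral.integral_const_mul,
      ← intervalIntegral.integral_add ((br_int hst.le cU).const_mul _)
        ((br_int hst.le cF).const_mul _)]
    apply intervalIntegral.integral_mono_on hst.le (br_int hst.le cP)
      (((br_int hst.le cU).const_mul _).add ((br_int hst.le cF).const_mul _))
    intro x _
    have y1 := mul_le_mul_of_nonneg_left
      (br_young hδ (g1 x + f3 x + l * f5 x) (d1 x + v3 x + l * v5 x)) hk1.le
    have y2 := mul_le_mul_of_nonneg_left (br_young hδ (f2 x) (v2 x)) hrho1.le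
    have y3 := mul_le_mul_of_nonneg_left (br_young hδ (g3 x) (d3 x)) hk2.le
    have y4 := mul_le_mul_of_nonneg_left (br_young hδ (f4 x) (v4 x)) hrho2.le
    have y5 := mul_le_mul_of_nonneg_left (br_young hδ (g5 x - l * f1 x) (d5 x - l * v1 x)) hk3.le
    have y6 := mul_le_mul_of_nonneg_left (br_young hδ (f6 x) (v6 x)) hrho1.le
    rw [hP]
    unfold brE
    linarith
  rw [intervalIntegral.integral_sub (br_int hst.le (by fun_prop)) (br_int hst.le cP),
    intervalIntegral.integral_const_mul] at key
  linarith

/-- Gronwall-type control of the displacement components. -/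
theorem br_gronwall {L l : ℝ} (hL : 0 < L) {w1 w3 w5 g1 g3 g5 : ℝ → ℂ}
    (c1 : ContinuousOn w1 (Icc 0 L)) (c3 : ContinuousOn w3 (Icc 0 L))
    (c5 : ContinuousOn w5 (Icc 0 L)) (cg1 : ContinuousOn g1 (Icc 0 L))
    (cg3 : ContinuousOn g3 (Icc 0 L)) (cg5 : ContinuousOn g5 (Icc 0 L))
    (D1 : ∀ x ∈ Ioo 0 L, HasDerivAt w1 (g1 x) x) (D3 : ∀ x ∈ Ioo 0 L, HasDerivAt w3 (g3 x) x)
    (D5 : ∀ x ∈ Ioo 0 L, HasDerivAt w5 (g5 x) x)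
    (z1 : w1 0 = 0) (z3 : w3 0 = 0) (z5 : w5 0 = 0) {x : ℝ} (hx : x ∈ Icc 0 L) :
    ‖w1 x‖ ^ 2 + ‖w3 x‖ ^ 2 + ‖w5 x‖ ^ 2 ≤ Real.exp (2 * L) * ∫ y in (0 : ℝ)..L,
      (‖g1 y + w3 y + l * w5 y‖ ^ 2 + ‖g3 y‖ ^ 2 + ‖g5 y - l * w1 y‖ ^ 2) := by
  set N : ℝ → ℝ := fun y => ‖g1 y + w3 y + l * w5 y‖ ^ 2 + ‖g3 y‖ ^ 2 + ‖g5 y - l * w1 y‖ ^ 2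
    with hN
  have cN : ContinuousOn N (Icc 0 L) := by fun_prop
  have nn : ∀ z : ℂ, ‖z‖ ^ 2 = z.re * z.re + z.im * z.im := fun z => by
    rw [Complex.sq_norm, Complex.normSq_apply]
  set K : ℝ → ℝ := fun y => 2 * ((w1 y).re * (g1 y).re + (w1 y).im * (g1 y).im)
    + 2 * ((w3 y).re * (g3 y).re + (w3 y).im * (g3 y).im)
    + 2 * ((w5 y).re * (g5 y).re + (w5 y).im * (g5 y).im) with hK
  have dre : ∀ {u : ℝ → ℂ} {u' : ℂ} {y : ℝ}, HasDerivAt u u' y →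
      HasDerivAt (fun y => (u y).re) u'.re y :=
    fun h => Complex.reCLM.hasFDerivAt.comp_hasDerivAt _ h
  have dim : ∀ {u : ℝ → ℂ} {u' : ℂ} {y : ℝ}, HasDerivAt u u' y →
      HasDerivAt (fun y => (u y).im) u'.im y :=
    fun h => Complex.imCLM.hasFDerivAt.comp_hasDerivAt _ h
  have cre : ∀ {u : ℝ → ℂ}, ContinuousOn u (Icc 0 L) →
      ContinuousOn (fun x => (u x).re) (Icc 0 L) :=
    fun h => Complex.continuous_re.comp_continuousOn h
  have cim : ∀ {u : ℝ → ℂ}, ContinuousOn u (Icc 0 L) →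
      ContinuousOn (fun x => (u x).im) (Icc 0 L) :=
    fun h => Complex.continuous_im.comp_continuousOn h
  have cK : ContinuousOn K (Icc 0 L) := by
    have := cre c1; have := cre c3; have := cre c5
    have := cim c1; have := cim c3; have := cim c5
    have := cre cg1; have := cre cg3; have := cre cg5
    have := cim cg1; have := cim cg3; have := cim cg5
    fun_prop
  have dsq : ∀ {u : ℝ → ℂ} {u' : ℂ} {y : ℝ}, HasDerivAt u u' y →
      HasDerivAt (fun y => ‖u y‖ ^ 2) (2 * ((u y).re * u'.re + (u y).im * u'.im)) y := by
    intro u u' y h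
    simp only [nn]
    exact (((dre h).fun_mul (dre h)).fun_add ((dim h).fun_mul (dim h))).congr_deriv (by ring)
  set E : ℝ → ℝ := fun y => ‖w1 y‖ ^ 2 + ‖w3 y‖ ^ 2 + ‖w5 y‖ ^ 2 with hE
  have cE : ContinuousOn E (Icc 0 L) := by fun_prop
  have sub : Icc 0 x ⊆ Icc 0 L := Icc_subset_Icc le_rfl hx.2
  have cI : ContinuousOn (fun y => Real.exp (-2 * y) * (K y - 2 * E y)) (Icc 0 L) := by fun_prop
  have ftc : ∫ y in (0 : ℝ)..x, Real.exp (-2 * y) * (K y - 2 * E y) =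
      Real.exp (-2 * x) * E x - Real.exp (-2 * 0) * E 0 := by
    apply intervalIntegral.integral_eq_sub_of_hasDerivAt_of_le hx.1
      (f := fun y => Real.exp (-2 * y) * E y)
    · exact ContinuousOn.mul (by fun_prop) (cE.mono sub)
    · intro y hy
      have hy' : y ∈ Ioo 0 L := ⟨hy.1, hy.2.trans_le hx.2⟩
      have h1 := ((hasDerivAt_id' y).const_mul (-2)).exp.fun_mul
        (((dsq (D1 y hy')).fun_add (dsq (D3 y hy'))).fun_add (dsq (D5 y hy')))
      refine h1.congr_deriv ?_
      simp only [hK, hE]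
      ring
    · exact br_int hx.1 (cI.mono sub)
  have E0 : E 0 = 0 := by simp [hE, z1, z3, z5]
  rw [E0, mul_zero, sub_zero] at ftc
  have hN0 : ∀ y, 0 ≤ N y := fun y => by simp only [hN]; positivity
  have le1 : ∫ y in (0 : ℝ)..x, Real.exp (-2 * y) * (K y - 2 * E y) ≤ ∫ y in (0 : ℝ)..x, N y := by
    apply intervalIntegral.integral_mono_on hx.1 (br_int hx.1 (cI.mono sub))
      (br_int hx.1 (cN.mono sub))
    intro y hy
    have h1 : K y - 2 * E y ≤ N y := by
      simp only [hK, hE, hN, nn, Complex.add_re, Complex.sub_re, Complex.mul_re, Complex.add_im,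
        Complex.sub_im, Complex.mul_im, Complex.ofReal_re, Complex.ofReal_im]
      nlinarith [sq_nonneg ((g1 y).re + (w3 y).re + l * (w5 y).re - (w1 y).re),
        sq_nonneg ((g1 y).im + (w3 y).im + l * (w5 y).im - (w1 y).im),
        sq_nonneg ((w1 y).re + (w3 y).re), sq_nonneg ((w1 y).im + (w3 y).im),
        sq_nonneg ((g5 y).re - l * (w1 y).re - (w5 y).re),
        sq_nonneg ((g5 y).im - l * (w1 y).im - (w5 y).im),
        sq_nonneg ((g3 y).re - (w3 y).re), sq_nonneg ((g3 y).im - (w3 y).im)]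
    have h2 : Real.exp (-2 * y) ≤ 1 := Real.exp_le_one_iff.2 (by linarith [hy.1])
    have h3 := Real.exp_pos (-2 * y)
    calc Real.exp (-2 * y) * (K y - 2 * E y) ≤ Real.exp (-2 * y) * N y := by gcongr
      _ ≤ 1 * N y := by gcongr
      _ = N y := one_mul _
  have le2 : ∫ y in (0 : ℝ)..x, N y ≤ ∫ y in (0 : ℝ)..L, N y :=
    intervalIntegral.integral_mono_interval le_rfl hx.1 hx.2
      (Eventually.of_forall hN0) (br_int hL.le cN)
  have h4 : Real.exp (-2 * x) * E x ≤ ∫ y in (0 : ℝ)..L, N y := by linarith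
  have h5 : E x = Real.exp (2 * x) * (Real.exp (-2 * x) * E x) := by
    rw [← mul_assoc, ← Real.exp_add]; simp
  have hI0 : 0 ≤ ∫ y in (0 : ℝ)..L, N y := intervalIntegral.integral_nonneg hL.le (fun y _ => hN0 y)
  calc E x = Real.exp (2 * x) * (Real.exp (-2 * x) * E x) := h5
    _ ≤ Real.exp (2 * x) * ∫ y in (0 : ℝ)..L, N y := by gcongr
    _ ≤ Real.exp (2 * L) * ∫ y in (0 : ℝ)..L, N y := by
      have := hx.2
      gcongr


/-- The one-sided derivative on `[0,L]`. -/
def brD (L : ℝ) (u : ℝ → ℂ) : ℝ → ℂ := derivWithin u (Icc 0 L)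

theorem brD_eq {L : ℝ} (u : ℝ → ℂ) {x : ℝ} (hx : x ∈ Ioo 0 L) : brD L u x = deriv u x :=
  derivWithin_of_mem_nhds (Icc_mem_nhds hx.1 hx.2)

theorem brD_cont {L : ℝ} (hL : 0 < L) {u : ℝ → ℂ} (h : ContDiffOn ℝ 1 u (Icc 0 L)) :
    ContinuousOn (brD L u) (Icc 0 L) :=
  h.continuousOn_derivWithin (uniqueDiffOn_Icc hL) le_rfl

theorem brD_has {L : ℝ} {u : ℝ → ℂ} (h : ContDiffOn ℝ 1 u (Icc 0 L)) {x : ℝ}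
    (hx : x ∈ Ioo 0 L) : HasDerivAt u (brD L u x) x := by
  rw [brD_eq u hx]
  exact ((h.contDiffAt (Icc_mem_nhds hx.1 hx.2)).differentiableAt one_ne_zero).hasDerivAt

theorem brD_has2 {L s t : ℝ} (hs : 0 ≤ s) (ht : t ≤ L) {u : ℝ → ℂ}
    (h : ContDiffOn ℝ 2 u (Icc s t)) {x : ℝ} (hx : x ∈ Ioo s t) :
    HasDerivAt (deriv u) (deriv (deriv u) x) x ∧ HasDerivAt (brD L u) (deriv (deriv u) x) x := by
  have h1 : ContDiffOn ℝ 1 (deriv u) (Ioo s t) :=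
    (h.mono Ioo_subset_Icc_self).deriv_of_isOpen isOpen_Ioo (by norm_num)
  have h2 : HasDerivAt (deriv u) (deriv (deriv u) x) x :=
    ((h1.contDiffAt (Ioo_mem_nhds hx.1 hx.2)).differentiableAt one_ne_zero).hasDerivAt
  refine ⟨h2, h2.congr_of_eventuallyEq ?_⟩
  filter_upwards [Ioo_mem_nhds hx.1 hx.2] with y hy
  exact brD_eq u ⟨hs.trans_lt hy.1, hy.2.trans_le ht⟩

/-- Extraction of `L²` control from the energy. -/
theorem br_part {β L c : ℝ} (hβ : 0 ≤ β) (hL : β ≤ L) (hc : 0 < c) {u : ℝ → ℂ} {e : ℝ → ℝ}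
    (cu : ContinuousOn u (Icc 0 L)) (ce : ContinuousOn e (Icc 0 L))
    (h : ∀ x, c * ‖u x‖ ^ 2 ≤ e x) :
    ∫ x in (0 : ℝ)..β, ‖u x‖ ^ 2 ≤ c⁻¹ * ∫ x in (0 : ℝ)..L, e x := by
  have h0 : (0 : ℝ) ≤ L := hβ.trans hL
  have h1 : ∫ x in (0 : ℝ)..β, ‖u x‖ ^ 2 ≤ ∫ x in (0 : ℝ)..L, ‖u x‖ ^ 2 :=
    intervalIntegral.integral_mono_interval le_rfl hβ hL
      (Eventually.of_forall fun x => by positivity) (br_int h0 (by fun_prop))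
  refine h1.trans ?_
  rw [← intervalIntegral.integral_const_mul]
  apply intervalIntegral.integral_mono_on h0 (br_int h0 (by fun_prop)) (br_int h0 (by fun_prop))
  intro x _
  rw [← div_eq_inv_mul, le_div_iff₀ hc]
  linarith [h x]

theorem br_part_bd {β L c C : ℝ} (hβ : 0 ≤ β) (hL : β ≤ L) (hc : 0 < c) {u : ℕ → ℝ → ℂ}
    {e : ℕ → ℝ → ℝ}
    (cu : ∀ n, ContinuousOn (u n) (Icc 0 L)) (ce : ∀ n, ContinuousOn (e n) (Icc 0 L))
    (h : ∀ n x, c * ‖u n x‖ ^ 2 ≤ e n x) (hE : ∀ n, ∫ x in (0 : ℝ)..L, e n x = C) : BrBd β u :=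
  ⟨fun n => (cu n).mono (Icc_subset_Icc le_rfl hL), c⁻¹ * C, fun n => by
    have := br_part hβ hL hc (cu n) (ce n) (h n)
    rwa [hE] at this⟩

theorem br_part_sm {β L c : ℝ} (hβ : 0 ≤ β) (hL : β ≤ L) (hc : 0 < c) {u : ℕ → ℝ → ℂ}
    {e : ℕ → ℝ → ℝ}
    (cu : ∀ n, ContinuousOn (u n) (Icc 0 L)) (ce : ∀ n, ContinuousOn (e n) (Icc 0 L))
    (h : ∀ n x, c * ‖u n x‖ ^ 2 ≤ e n x)
    (hE : Tendsto (fun n => ∫ x in (0 : ℝ)..L, e n x) atTop (nhds 0)) : BrSm β u := by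
  refine ⟨fun n => (cu n).mono (Icc_subset_Icc le_rfl hL), ?_⟩
  have h1 := hE.const_mul c⁻¹
  rw [mul_zero] at h1
  exact squeeze_zero (fun n => intervalIntegral.integral_nonneg hβ (fun x _ => by positivity))
    (fun n => br_part hβ hL hc (cu n) (ce n) (h n)) h1

theorem br_sup_sm {β L c : ℝ} (hβ : 0 ≤ β) (hL : β ≤ L) {u : ℕ → ℝ → ℂ} {m : ℕ → ℝ}
    (cu : ∀ n, ContinuousOn (u n) (Icc 0 L)) (h : ∀ n, ∀ x ∈ Icc 0 L, ‖u n x‖ ^ 2 ≤ c * m n)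
    (hE : Tendsto m atTop (nhds 0)) : BrSm β u := by
  refine ⟨fun n => (cu n).mono (Icc_subset_Icc le_rfl hL), ?_⟩
  have h1 := (hE.const_mul c).const_mul β
  rw [mul_zero, mul_zero] at h1
  refine squeeze_zero (fun n => intervalIntegral.integral_nonneg hβ (fun x _ => by positivity))
    (fun n => ?_) h1
  have cu' := (cu n).mono (Icc_subset_Icc le_rfl hL)
  have : ∫ x in (0 : ℝ)..β, ‖u n x‖ ^ 2 ≤ ∫ x in (0 : ℝ)..β, c * m n := by
    apply intervalIntegral.integral_mono_on hβ (br_int hβ (by fun_prop))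
      (br_int hβ continuousOn_const)
    intro x hx
    exact h n x ⟨hx.1, hx.2.trans hL⟩
  rwa [intervalIntegral.integral_const, sub_zero, smul_eq_mul] at this

/-- Removing the weight on an interior interval. -/
theorem br_unweight {b ε : ℝ} (hε : 0 < ε) (hεb : ε < b / 12) {u : ℕ → ℝ → ℂ}
    (cu : ∀ n, ContinuousOn (u n) (Icc 0 b)) (h : BrSm b (fun n x => brp b x * u n x)) :
    Tendsto (fun n => ∫ x in (2 * ε)..(b - 2 * ε), ‖u n x‖ ^ 2) atTop (nhds 0) := by
  have hb : 0 < b := by linarith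
  have hle : 2 * ε ≤ b - 2 * ε := by linarith
  have hsub : Icc (2 * ε) (b - 2 * ε) ⊆ Icc 0 b := Icc_subset_Icc (by linarith) (by linarith)
  set c : ℝ := (2 * ε * (2 * ε)) ^ 2 with hc
  have hc0 : 0 < c := by positivity
  have h1 := h.2.const_mul c⁻¹
  rw [mul_zero] at h1
  refine squeeze_zero (fun n => intervalIntegral.integral_nonneg hle (fun x _ => by positivity))
    (fun n => ?_) h1
  have cp : ContinuousOn (fun x => ‖brp b x * u n x‖ ^ 2) (Icc 0 b) := by
    have := cu n
    fun_prop
  have h2 : ∫ x in (2 * ε)..(b - 2 * ε), ‖brp b x * u n x‖ ^ 2 ≤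
      ∫ x in (0 : ℝ)..b, ‖brp b x * u n x‖ ^ 2 :=
    intervalIntegral.integral_mono_interval (by linarith) hle (by linarith)
      (Eventually.of_forall fun x => by positivity) (br_int hb.le cp)
  have h3 : ∫ x in (2 * ε)..(b - 2 * ε), ‖u n x‖ ^ 2 ≤
      c⁻¹ * ∫ x in (2 * ε)..(b - 2 * ε), ‖brp b x * u n x‖ ^ 2 := by
    rw [← intervalIntegral.integral_const_mul]
    have cu' := (cu n).mono hsub
    apply intervalIntegral.integral_mono_on hle (br_int hle (by fun_prop))
      ((br_int hle (cp.mono hsub)).const_mul _)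
    intro x hx
    rw [← div_eq_inv_mul, le_div_iff₀ hc0, norm_mul, mul_pow, mul_comm]
    have hp : c ≤ ‖brp b x‖ ^ 2 := by
      rw [brp, Complex.norm_real, Real.norm_eq_abs, sq_abs, hc]
      have a1 := hx.1
      have a2 : 2 * ε ≤ b - x := by linarith [hx.2]
      have a0 : 0 ≤ x := by linarith
      gcongr
    gcongr
  refine h3.trans ?_
  gcongr

set_option maxHeartbeats 1000000 in
theorem bresse_lemma4_estimates (ρ₁ ρ₂ k₁ k₂ k₃ l L β a₀ : ℝ) (ℓ : ℕ)
    (hrho1 : 0 < ρ₁) (hrho2 : 0 < ρ₂) (hk1 : 0 < k₁) (hk2 : 0 < k₂) (hk3 : 0 < k₃)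
    (hl : 0 < l) (hL : 0 < L) (ha0 : 0 < a₀) (hbeta : 0 < β) (hbetaL : β < L)
    (S : BresseSetting ρ₁ ρ₂ k₁ k₂ k₃ l L β a₀ ℓ)
    (hH : k₁ / ρ₁ = k₂ / ρ₂ ∧ k₁ = k₃ ∧ ℓ = 0) :
    ∀ ε : ℝ, 0 < ε → ε < β / 12 →
    Tendsto (fun n => ∫ x in (2 * ε)..(β - 2 * ε), ‖deriv (S.v1 n) x‖ ^ 2) atTop (nhds 0) ∧
    Tendsto (fun n => (S.lam n) ^ 2 * ∫ x in (2 * ε)..(β - 2 * ε), ‖S.v1 n x‖ ^ 2)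
      atTop (nhds 0) := by
  obtain ⟨-, hk13, rfl⟩ := hH
  subst hk13
  intro ε hε hεβ
  have hβL := hbetaL.le
  have hk1C : (k₁ : ℂ) ≠ 0 := by exact_mod_cast hk1.ne'
  have hk2C : (k₂ : ℂ) ≠ 0 := by exact_mod_cast hk2.ne'
  -- abbreviations for the derivatives
  set d1 : ℕ → ℝ → ℂ := fun n => brD L (S.v1 n) with hd1
  set d3 : ℕ → ℝ → ℂ := fun n => brD L (S.v3 n) with hd3
  set d5 : ℕ → ℝ → ℂ := fun n => brD L (S.v5 n) with hd5
  set g1 : ℕ → ℝ → ℂ := fun n => brD L (S.f1 n) with hg1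
  set g3 : ℕ → ℝ → ℂ := fun n => brD L (S.f3 n) with hg3
  set g5 : ℕ → ℝ → ℂ := fun n => brD L (S.f5 n) with hg5
  have r1 : ∀ n, ContDiffOn ℝ 1 (S.v1 n) (Icc 0 L) := fun n => (S.reg_v1 n).of_le (by norm_num)
  have r3 : ∀ n, ContDiffOn ℝ 1 (S.v3 n) (Icc 0 L) := fun n => (S.reg_v3 n).of_le (by norm_num)
  have cv1 := fun n => (r1 n).continuousOn
  have cv2 := fun n => (S.reg_v2 n).continuousOn
  have cv3 := fun n => (r3 n).continuousOn
  have cv4 := fun n => (S.reg_v4 n).continuousOn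
  have cv5 := fun n => (S.reg_v5 n).continuousOn
  have cv6 := fun n => (S.reg_v6 n).continuousOn
  have cf1 := fun n => (S.reg_f1 n).continuousOn
  have cf2 := S.reg_f2
  have cf3 := fun n => (S.reg_f3 n).continuousOn
  have cf4 := S.reg_f4
  have cf5 := fun n => (S.reg_f5 n).continuousOn
  have cf6 := S.reg_f6
  have cd1 : ∀ n, ContinuousOn (d1 n) (Icc 0 L) := fun n => brD_cont hL (r1 n)
  have cd3 : ∀ n, ContinuousOn (d3 n) (Icc 0 L) := fun n => brD_cont hL (r3 n)
  have cd5 : ∀ n, ContinuousOn (d5 n) (Icc 0 L) := fun n => brD_cont hL (S.reg_v5 n)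
  have cg1 : ∀ n, ContinuousOn (g1 n) (Icc 0 L) := fun n => brD_cont hL (S.reg_f1 n)
  have cg3 : ∀ n, ContinuousOn (g3 n) (Icc 0 L) := fun n => brD_cont hL (S.reg_f3 n)
  have cg5 : ∀ n, ContinuousOn (g5 n) (Icc 0 L) := fun n => brD_cont hL (S.reg_f5 n)
  have Dv1 : ∀ n, ∀ x ∈ Ioo 0 L, HasDerivAt (S.v1 n) (d1 n x) x := fun n x hx => brD_has (r1 n) hx
  have Dv3 : ∀ n, ∀ x ∈ Ioo 0 L, HasDerivAt (S.v3 n) (d3 n x) x := fun n x hx => brD_has (r3 n) hx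
  have Dv5 : ∀ n, ∀ x ∈ Ioo 0 L, HasDerivAt (S.v5 n) (d5 n x) x :=
    fun n x hx => brD_has (S.reg_v5 n) hx
  have Df1 : ∀ n, ∀ x ∈ Ioo 0 L, HasDerivAt (S.f1 n) (g1 n x) x :=
    fun n x hx => brD_has (S.reg_f1 n) hx
  have Df3 : ∀ n, ∀ x ∈ Ioo 0 L, HasDerivAt (S.f3 n) (g3 n x) x :=
    fun n x hx => brD_has (S.reg_f3 n) hx
  have Df5 : ∀ n, ∀ x ∈ Ioo 0 L, HasDerivAt (S.f5 n) (g5 n x) x :=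
    fun n x hx => brD_has (S.reg_f5 n) hx
  -- the energies
  set eU : ℕ → ℝ → ℝ := fun n x => brE ρ₁ ρ₂ k₁ k₂ k₁ (d1 n x + S.v3 n x + l * S.v5 n x) (S.v2 n x)
    (d3 n x) (S.v4 n x) (d5 n x - l * S.v1 n x) (S.v6 n x) with heU
  set eF : ℕ → ℝ → ℝ := fun n x => brE ρ₁ ρ₂ k₁ k₂ k₁ (g1 n x + S.f3 n x + l * S.f5 n x) (S.f2 n x)
    (g3 n x) (S.f4 n x) (g5 n x - l * S.f1 n x) (S.f6 n x) with heF
  have ceU : ∀ n, ContinuousOn (eU n) (Icc 0 L) := by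
    intro n
    have := cv1 n; have := cv2 n; have := cv3 n; have := cv4 n; have := cv5 n; have := cv6 n
    have := cd1 n; have := cd3 n; have := cd5 n
    simp only [heU, brE]
    fun_prop
  have ceF : ∀ n, ContinuousOn (eF n) (Icc 0 L) := by
    intro n
    have := cf1 n; have := cf2 n; have := cf3 n; have := cf4 n; have := cf5 n; have := cf6 n
    have := cg1 n; have := cg3 n; have := cg5 n
    simp only [heF, brE]
    fun_prop
  have nU : ∀ n, ∫ x in (0 : ℝ)..L, eU n x = 1 := by
    intro n
    rw [← S.normU n]
    refine br_congr hL.le (fun x hx => ?_)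
    simp only [heU, brE, hd1, hd3, hd5, brD_eq _ hx]
  have nF : Tendsto (fun n => ∫ x in (0 : ℝ)..L, eF n x) atTop (nhds 0) := by
    refine S.normF.congr (fun n => ?_)
    refine br_congr hL.le (fun x hx => ?_)
    simp only [heF, brE, hg1, hg3, hg5, brD_eq _ hx]
  -- the equations
  have E1 : ∀ n, ∀ x ∈ Ioo 0 β ∪ Ioo β L,
      Complex.I * (S.lam n : ℂ) * S.v1 n x - S.v2 n x = S.f1 n x :=
    fun n x hx => by simpa using S.eq1 n x hx
  have E3 : ∀ n, ∀ x ∈ Ioo 0 β ∪ Ioo β L,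
      Complex.I * (S.lam n : ℂ) * S.v3 n x - S.v4 n x = S.f3 n x :=
    fun n x hx => by simpa using S.eq3 n x hx
  have E5 : ∀ n, ∀ x ∈ Ioo 0 β ∪ Ioo β L,
      Complex.I * (S.lam n : ℂ) * S.v5 n x - S.v6 n x = S.f5 n x :=
    fun n x hx => by simpa using S.eq5 n x hx
  have hin : ∀ x ∈ Ioo 0 β ∪ Ioo β L, x ∈ Ioo 0 L := by
    rintro x (hx | hx)
    · exact ⟨hx.1, hx.2.trans hbetaL⟩
    · exact ⟨hbeta.trans hx.1, hx.2⟩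
  have hopen : IsOpen (Ioo 0 β ∪ Ioo β L) := isOpen_Ioo.union isOpen_Ioo
  have DW : ∀ (lam : ℝ) {v w f : ℝ → ℂ} {d g : ℝ → ℂ} {x : ℝ}, x ∈ Ioo 0 β ∪ Ioo β L →
      (∀ y ∈ Ioo 0 β ∪ Ioo β L, Complex.I * (lam : ℂ) * v y - w y = f y) →
      HasDerivAt v (d x) x → HasDerivAt f (g x) x →
      HasDerivAt w (Complex.I * (lam : ℂ) * d x - g x) x := by
    intro lam v w f d g x hx hE hv hf
    have h1 := (hv.const_mul (Complex.I * (lam : ℂ))).fun_sub hf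
    refine h1.congr_of_eventuallyEq ?_
    filter_upwards [hopen.mem_nhds hx] with y hy
    rw [← hE y hy]
    ring
  have Dv2 : ∀ n, ∀ x ∈ Ioo 0 β ∪ Ioo β L,
      HasDerivAt (S.v2 n) (Complex.I * (S.lam n : ℂ) * d1 n x - g1 n x) x :=
    fun n x hx => DW (S.lam n) hx (E1 n) (Dv1 n x (hin x hx)) (Df1 n x (hin x hx))
  have Dv4 : ∀ n, ∀ x ∈ Ioo 0 β ∪ Ioo β L,
      HasDerivAt (S.v4 n) (Complex.I * (S.lam n : ℂ) * d3 n x - g3 n x) x :=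
    fun n x hx => DW (S.lam n) hx (E3 n) (Dv3 n x (hin x hx)) (Df3 n x (hin x hx))
  have Dv6 : ∀ n, ∀ x ∈ Ioo 0 β ∪ Ioo β L,
      HasDerivAt (S.v6 n) (Complex.I * (S.lam n : ℂ) * d5 n x - g5 n x) x :=
    fun n x hx => DW (S.lam n) hx (E5 n) (Dv5 n x (hin x hx)) (Df5 n x (hin x hx))
  have DS1 : ∀ n, ∀ x ∈ Ioo 0 β ∪ Ioo β L,
      HasDerivAt (fun x => d1 n x + S.v3 n x + l * S.v5 n x)
      ((k₁ : ℂ)⁻¹ * (Complex.I * (S.lam n : ℂ) * ρ₁ * S.v2 n x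
        - l * k₁ * (d5 n x - l * S.v1 n x) - ρ₁ * S.f2 n x)) x := by
    intro n x hx
    have hx' := hin x hx
    obtain ⟨q1, q2⟩ := brD_has2 le_rfl le_rfl (S.reg_v1 n) hx'
    have p1 := (q1.fun_add (Dv3 n x hx')).fun_add ((Dv5 n x hx').const_mul (l : ℂ))
    have p2 := (q2.fun_add (Dv3 n x hx')).fun_add ((Dv5 n x hx').const_mul (l : ℂ))
    refine p2.congr_deriv ?_
    have e := S.eq2 n x hx
    rw [p1.deriv, ← brD_eq (S.v5 n) hx'] at e
    simp only [Nat.cast_zero, neg_zero, zpow_zero, mul_one] at e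
    rw [eq_inv_mul_iff_mul_eq₀ hk1C]
    simp only [hd5]
    linear_combination -e
  have Dd3 : ∀ n, ∀ x ∈ Ioo 0 β ∪ Ioo β L, HasDerivAt (d3 n)
      ((k₂ : ℂ)⁻¹ * (Complex.I * (S.lam n : ℂ) * ρ₂ * S.v4 n x
        + k₁ * (d1 n x + S.v3 n x + l * S.v5 n x) - ρ₂ * S.f4 n x)) x := by
    intro n x hx
    have hx' := hin x hx
    obtain ⟨q1, q2⟩ := brD_has2 le_rfl le_rfl (S.reg_v3 n) hx'
    refine q2.congr_deriv ?_
    have e := S.eq4 n x hx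
    rw [← brD_eq (S.v1 n) hx'] at e
    simp only [Nat.cast_zero, neg_zero, zpow_zero, mul_one] at e
    rw [eq_inv_mul_iff_mul_eq₀ hk2C]
    simp only [hd1]
    linear_combination -e
  have DS3 : ∀ n, ∀ x ∈ Ioo 0 β ∪ Ioo β L, HasDerivAt (fun x => d5 n x - l * S.v1 n x)
      ((k₁ : ℂ)⁻¹ * (Complex.I * (S.lam n : ℂ) * ρ₁ * S.v6 n x
        + l * k₁ * (d1 n x + S.v3 n x + l * S.v5 n x)
        + (if x < β then (a₀ : ℂ) else 0) * S.v6 n x - ρ₁ * S.f6 n x)) x := by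
    intro n x hx
    have hx' := hin x hx
    obtain ⟨q1, q2⟩ : HasDerivAt (deriv (S.v5 n)) (deriv (deriv (S.v5 n)) x) x ∧
        HasDerivAt (brD L (S.v5 n)) (deriv (deriv (S.v5 n)) x) x := by
      rcases hx with hx | hx
      · exact brD_has2 le_rfl hβL (S.reg_v5_left n) hx
      · exact brD_has2 hbeta.le le_rfl (S.reg_v5_right n) hx
    have p1 := q1.fun_sub ((Dv1 n x hx').const_mul (l : ℂ))
    have p2 := q2.fun_sub ((Dv1 n x hx').const_mul (l : ℂ))
    refine p2.congr_deriv ?_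
    have e := S.eq6 n x hx
    rw [p1.deriv, ← brD_eq (S.v1 n) hx'] at e
    simp only [Nat.cast_zero, neg_zero, zpow_zero, mul_one] at e
    rw [eq_inv_mul_iff_mul_eq₀ hk1C]
    simp only [hd1] at e ⊢
    linear_combination -e
  -- dissipation
  have sl : Icc 0 β ⊆ Icc 0 L := Icc_subset_Icc le_rfl hβL
  have sr : Icc β L ⊆ Icc 0 L := Icc_subset_Icc hbeta.le le_rfl
  have diss : ∀ n (δ : ℝ), 0 < δ → a₀ * ∫ x in (0 : ℝ)..β, ‖S.v6 n x‖ ^ 2 ≤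
      δ / 2 + 1 / (2 * δ) * ∫ x in (0 : ℝ)..L, eF n x := by
    intro n δ hδ
    have A1 := br_flux (a := a₀) hbeta hrho1 hrho2 hk1 hk2 hk1 hδ ((cv1 n).mono sl)
      ((cv2 n).mono sl)
      ((cv3 n).mono sl) ((cv4 n).mono sl) ((cv5 n).mono sl) ((cv6 n).mono sl) ((cd1 n).mono sl)
      ((cd3 n).mono sl) ((cd5 n).mono sl) ((cf1 n).mono sl) ((cf2 n).mono sl) ((cf3 n).mono sl)
      ((cf4 n).mono sl) ((cf5 n).mono sl) ((cf6 n).mono sl) ((cg1 n).mono sl) ((cg3 n).mono sl)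
      ((cg5 n).mono sl) (fun x hx => E1 n x (Or.inl hx)) (fun x hx => E3 n x (Or.inl hx))
      (fun x hx => E5 n x (Or.inl hx)) (fun x hx => Dv2 n x (Or.inl hx))
      (fun x hx => Dv4 n x (Or.inl hx)) (fun x hx => Dv6 n x (Or.inl hx))
      (fun x hx => DS1 n x (Or.inl hx)) (fun x hx => Dd3 n x (Or.inl hx))
      (fun x hx => by simpa only [if_pos hx.2] using DS3 n x (Or.inl hx))
    have A2 := br_flux (a := 0) hbetaL hrho1 hrho2 hk1 hk2 hk1 hδ ((cv1 n).mono sr)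
      ((cv2 n).mono sr)
      ((cv3 n).mono sr) ((cv4 n).mono sr) ((cv5 n).mono sr) ((cv6 n).mono sr) ((cd1 n).mono sr)
      ((cd3 n).mono sr) ((cd5 n).mono sr) ((cf1 n).mono sr) ((cf2 n).mono sr) ((cf3 n).mono sr)
      ((cf4 n).mono sr) ((cf5 n).mono sr) ((cf6 n).mono sr) ((cg1 n).mono sr) ((cg3 n).mono sr)
      ((cg5 n).mono sr) (fun x hx => E1 n x (Or.inr hx)) (fun x hx => E3 n x (Or.inr hx))
      (fun x hx => E5 n x (Or.inr hx)) (fun x hx => Dv2 n x (Or.inr hx))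
      (fun x hx => Dv4 n x (Or.inr hx)) (fun x hx => Dv6 n x (Or.inr hx))
      (fun x hx => DS1 n x (Or.inr hx)) (fun x hx => Dd3 n x (Or.inr hx))
      (fun x hx => by simpa only [if_neg hx.1.not_gt, Complex.ofReal_zero] using DS3 n x (Or.inr hx))
    have hG0 : brG k₁ k₂ k₁ (d1 n 0 + S.v3 n 0 + l * S.v5 n 0) (S.v2 n 0) (d3 n 0) (S.v4 n 0)
        (d5 n 0 - l * S.v1 n 0) (S.v6 n 0) = 0 := by
      obtain ⟨-, b2, -, b4, -, b6, -⟩ := S.bc_zero n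
      simp [brG, b2, b4, b6]
    have hGL : brG k₁ k₂ k₁ (d1 n L + S.v3 n L + l * S.v5 n L) (S.v2 n L) (d3 n L) (S.v4 n L)
        (d5 n L - l * S.v1 n L) (S.v6 n L) = 0 := by
      obtain ⟨-, b2, -, b4, -, b6, -⟩ := S.bc_L n
      simp [brG, b2, b4, b6]
    have IU := intervalIntegral.integral_add_adjacent_intervals
      (br_int hbeta.le ((ceU n).mono sl)) (br_int hβL ((ceU n).mono sr))
    have IF := intervalIntegral.integral_add_adjacent_intervals
      (br_int hbeta.le ((ceF n).mono sl)) (br_int hβL ((ceF n).mono sr))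
    rw [nU n] at IU
    rw [hG0] at A1
    rw [hGL] at A2
    have IU' := congrArg (fun z => δ / 2 * z) IU
    have IF' := congrArg (fun z => 1 / (2 * δ) * z) IF
    simp only [mul_add] at IU' IF'
    simp only [heU, heF] at IU' IF' ⊢
    linarith
  have hv6 : BrSm β S.v6 := by
    refine ⟨fun n => (cv6 n).mono sl, ?_⟩
    rw [Metric.tendsto_atTop]
    intro e he
    set δ : ℝ := a₀ * e with hδ
    have hδ0 : 0 < δ := by positivity
    obtain ⟨N, hN⟩ := (Metric.tendsto_atTop.1 nF) (δ ^ 2) (by positivity)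
    refine ⟨N, fun n hn => ?_⟩
    have h1 := hN n hn
    rw [Real.dist_eq, sub_zero] at h1
    have h2 := (le_abs_self _).trans_lt h1
    rw [Real.dist_eq, sub_zero, abs_of_nonneg (br_sq_nonneg hbeta _)]
    have h3 := diss n δ hδ0
    have h4 : 1 / (2 * δ) * ∫ x in (0 : ℝ)..L, eF n x < 1 / (2 * δ) * δ ^ 2 := by gcongr
    have h5 : 1 / (2 * δ) * δ ^ 2 = δ / 2 := by field_simp
    have h6 : a₀ * ∫ x in (0 : ℝ)..β, ‖S.v6 n x‖ ^ 2 < a₀ * e := by linarith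
    exact lt_of_mul_lt_mul_left h6 ha0.le
  -- energy components
  have pw : ∀ (s1 v2 d3 v4 s3 v6 : ℂ), k₁ * ‖s1‖ ^ 2 ≤ brE ρ₁ ρ₂ k₁ k₂ k₁ s1 v2 d3 v4 s3 v6 ∧
      ρ₁ * ‖v2‖ ^ 2 ≤ brE ρ₁ ρ₂ k₁ k₂ k₁ s1 v2 d3 v4 s3 v6 ∧
      k₂ * ‖d3‖ ^ 2 ≤ brE ρ₁ ρ₂ k₁ k₂ k₁ s1 v2 d3 v4 s3 v6 ∧
      ρ₂ * ‖v4‖ ^ 2 ≤ brE ρ₁ ρ₂ k₁ k₂ k₁ s1 v2 d3 v4 s3 v6 ∧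
      k₁ * ‖s3‖ ^ 2 ≤ brE ρ₁ ρ₂ k₁ k₂ k₁ s1 v2 d3 v4 s3 v6 ∧
      ρ₁ * ‖v6‖ ^ 2 ≤ brE ρ₁ ρ₂ k₁ k₂ k₁ s1 v2 d3 v4 s3 v6 := by
    intro s1 v2 d3 v4 s3 v6
    have a1 : 0 ≤ k₁ * ‖s1‖ ^ 2 := by positivity
    have a2 : 0 ≤ ρ₁ * ‖v2‖ ^ 2 := by positivity
    have a3 : 0 ≤ k₂ * ‖d3‖ ^ 2 := by positivity
    have a4 : 0 ≤ ρ₂ * ‖v4‖ ^ 2 := by positivity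
    have a5 : 0 ≤ k₁ * ‖s3‖ ^ 2 := by positivity
    have a6 : 0 ≤ ρ₁ * ‖v6‖ ^ 2 := by positivity
    unfold brE
    refine ⟨?_, ?_, ?_, ?_, ?_, ?_⟩ <;> linarith
  have hv2 : BrBd β S.v2 := br_part_bd hbeta.le hβL hrho1 cv2 ceU (fun n x => (pw _ _ _ _ _ _).2.1) nU
  have hv4 : BrBd β S.v4 :=
    br_part_bd hbeta.le hβL hrho2 cv4 ceU (fun n x => (pw _ _ _ _ _ _).2.2.2.1) nU
  have hbd3 : BrBd β d3 := br_part_bd hbeta.le hβL hk2 cd3 ceU (fun n x => (pw _ _ _ _ _ _).2.2.1) nU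
  have hS1 : BrBd β (fun n x => d1 n x + S.v3 n x + (l : ℂ) * S.v5 n x) :=
    br_part_bd hbeta.le hβL hk1
      (fun n => by have := cd1 n; have := cv3 n; have := cv5 n; fun_prop) ceU
      (fun n x => (pw _ _ _ _ _ _).1) nU
  have hS3 : BrBd β (fun n x => d5 n x - (l : ℂ) * S.v1 n x) :=
    br_part_bd hbeta.le hβL hk1 (fun n => by have := cd5 n; have := cv1 n; fun_prop) ceU
      (fun n x => (pw _ _ _ _ _ _).2.2.2.2.1) nU
  have hf2 : BrSm β S.f2 := br_part_sm hbeta.le hβL hrho1 cf2 ceF (fun n x => (pw _ _ _ _ _ _).2.1) nF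
  have hf6 : BrSm β S.f6 :=
    br_part_sm hbeta.le hβL hrho1 cf6 ceF (fun n x => (pw _ _ _ _ _ _).2.2.2.2.2) nF
  have hΦ1 : BrSm β (fun n x => g1 n x + S.f3 n x + (l : ℂ) * S.f5 n x) :=
    br_part_sm hbeta.le hβL hk1
      (fun n => by have := cg1 n; have := cf3 n; have := cf5 n; fun_prop) ceF
      (fun n x => (pw _ _ _ _ _ _).1) nF
  have hΦ3 : BrSm β (fun n x => g5 n x - (l : ℂ) * S.f1 n x) :=
    br_part_sm hbeta.le hβL hk1 (fun n => by have := cg5 n; have := cf1 n; fun_prop) ceF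
      (fun n x => (pw _ _ _ _ _ _).2.2.2.2.1) nF
  -- Gronwall
  have gr : ∀ n, ∀ x ∈ Icc 0 L, ‖S.f1 n x‖ ^ 2 + ‖S.f3 n x‖ ^ 2 + ‖S.f5 n x‖ ^ 2 ≤
      (Real.exp (2 * L) * (2 * k₁⁻¹ + k₂⁻¹)) * ∫ x in (0 : ℝ)..L, eF n x := by
    intro n x hx
    obtain ⟨-, -, -, -, -, -, z1, z3, z5⟩ := S.bc_zero n
    refine (br_gronwall (l := l) hL (cf1 n) (cf3 n) (cf5 n) (cg1 n) (cg3 n) (cg5 n) (Df1 n) (Df3 n)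
      (Df5 n) z1 z3 z5 hx).trans ?_
    rw [mul_assoc]
    gcongr
    rw [← intervalIntegral.integral_const_mul]
    apply intervalIntegral.integral_mono_on hL.le
    · have := cf1 n; have := cf3 n; have := cf5 n
      have := cg1 n; have := cg3 n; have := cg5 n
      exact br_int hL.le (by fun_prop)
    · exact (br_int hL.le (ceF n)).const_mul _
    · intro y _
      have P := pw (g1 n y + S.f3 n y + l * S.f5 n y) (S.f2 n y) (g3 n y) (S.f4 n y)
        (g5 n y - l * S.f1 n y) (S.f6 n y)
      have q1 := P.1
      have q3 := P.2.2.1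
      have q5 := P.2.2.2.2.1
      change _ ≤ eF n y at q1
      change _ ≤ eF n y at q3
      change _ ≤ eF n y at q5
      rw [← le_inv_mul_iff₀ hk1] at q1 q5
      rw [← le_inv_mul_iff₀ hk2] at q3
      linarith
  have hf1 : BrSm β S.f1 := br_sup_sm (c := Real.exp (2 * L) * (2 * k₁⁻¹ + k₂⁻¹)) hbeta.le hβL cf1
    (fun n x hx => by linarith [gr n x hx, sq_nonneg ‖S.f3 n x‖, sq_nonneg ‖S.f5 n x‖]) nF
  have hf3 : BrSm β S.f3 := br_sup_sm (c := Real.exp (2 * L) * (2 * k₁⁻¹ + k₂⁻¹)) hbeta.le hβL cf3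
    (fun n x hx => by linarith [gr n x hx, sq_nonneg ‖S.f1 n x‖, sq_nonneg ‖S.f5 n x‖]) nF
  have hf5 : BrSm β S.f5 := br_sup_sm (c := Real.exp (2 * L) * (2 * k₁⁻¹ + k₂⁻¹)) hbeta.le hβL cf5
    (fun n x hx => by linarith [gr n x hx, sq_nonneg ‖S.f1 n x‖, sq_nonneg ‖S.f3 n x‖]) nF
  have hsg1 : BrSm β g1 := ((hΦ1.sub hbeta hf3).sub hbeta
    (hf5.cmul hbeta (fun _ => (l : ℂ)) continuousOn_const)).congr hbeta
    (fun n => (cg1 n).mono sl) (fun n x _ => by ring)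
  have hsg5 : BrSm β g5 := (hΦ3.add hbeta
    (hf1.cmul hbeta (fun _ => (l : ℂ)) continuousOn_const)).congr hbeta
    (fun n => (cg5 n).mono sl) (fun n x _ => by ring)
  have inL : ∀ {x : ℝ}, x ∈ Ioo 0 β → x ∈ Ioo 0 L := fun hx => hin _ (Or.inl hx)
  obtain ⟨R1, R2⟩ := br_core (a₀ := a₀) hbeta hrho1 hk1 hl S.lam_ne S.lam_tendsto hv2 hv4 hv6 hS1
    hbd3 hS3 hf1 hf2 hf3 hf5 hf6 hsg1 hsg5 (fun n => (cv1 n).mono sl) (fun n => (cv3 n).mono sl)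
    (fun n => (cv5 n).mono sl) (fun n => (cd1 n).mono sl) (fun n => (cd5 n).mono sl)
    (fun n x hx => Dv1 n x (inL hx)) (fun n x hx => Dv3 n x (inL hx))
    (fun n x hx => Dv5 n x (inL hx)) (fun n x hx => Df1 n x (inL hx))
    (fun n x hx => Df5 n x (inL hx)) (fun n x hx => E1 n x (Or.inl hx))
    (fun n x hx => E3 n x (Or.inl hx)) (fun n x hx => E5 n x (Or.inl hx))
    (fun n x hx => by
      have h1 := ((DS1 n x (Or.inl hx)).fun_sub (Dv3 n x (inL hx))).fun_sub
        ((Dv5 n x (inL hx)).const_mul (l : ℂ))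
      refine (h1.congr_of_eventuallyEq (Eventually.of_forall fun y => ?_)).congr_deriv ?_
      · ring
      · field_simp
        ring)
    (fun n x hx => by
      have h1 := (DS3 n x (Or.inl hx)).fun_add ((Dv1 n x (inL hx)).const_mul (l : ℂ))
      rw [if_pos hx.2] at h1
      refine (h1.congr_of_eventuallyEq (Eventually.of_forall fun y => ?_)).congr_deriv ?_
      · ring
      · field_simp
        ring)
  have T1 := br_unweight hε hεβ (fun n => (cd1 n).mono sl) R1
  have T2 := br_unweight hε hεβ (fun n => continuousOn_const.mul ((cv1 n).mono sl)) R2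
  have hle : 2 * ε ≤ β - 2 * ε := by linarith
  constructor
  · refine T1.congr (fun n => br_congr hle (fun x hx => ?_))
    have hx' : x ∈ Ioo 0 L := ⟨by linarith [hx.1], by linarith [hx.2]⟩
    simp only [hd1, brD_eq _ hx']
  · refine T2.congr (fun n => ?_)
    rw [← intervalIntegral.integral_const_mul]
    refine br_congr hle (fun x _ => ?_)
    simp [mul_pow]
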